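/- Let 0 < a ≤ 1/2, let k > 0 and δ > 0, set x := e^{−iπ/4}·e^{iδ/2}, and define I_{x,k}(s,a) := (1/(2πi)) ∫_{s−ik}^{s+ik} π^{−v/2} Γ(v/2) Q(v,a) x^{v−1} dv (integration along the vertical segment). There exists a constant K > 0 such that for every ε > 0 there is δ₀ > 0 with the property: for all 0 < δ < δ₀ and all k > 0, (1/(2π)) ∫_{−∞}^{∞} | I_{x,k}(1/2 + it, a) |² dt < (K·k + ε·k²) / δ^{1/2}. -/

import Mathlib

open Complex MeasureTheory

/-- The Hurwitz zeta function `ζ(s, a)`. -/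
noncomputable def hzeta (a : ℝ) (s : ℂ) : ℂ := HurwitzZeta.hurwitzZeta (a : UnitAddCircle) s

/-- The periodic (exponential) zeta function `Li(s, a)`. -/
noncomputable def pzeta (a : ℝ) (s : ℂ) : ℂ := HurwitzZeta.expZeta (a : UnitAddCircle) s

/-- The quadrilateral zeta function `Q(s, a)`, defined by
`2Q(s,a) = ζ(s,a) + ζ(s,1−a) + Li(s,a) + Li(s,1−a)`. -/
noncomputable def Qzeta (s : ℂ) (a : ℝ) : ℂ :=
  (hzeta a s + hzeta (1 - a) s + pzeta a s + pzeta (1 - a) s) / 2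

/-- The contour integral `I_{x,k}(s,a) = (1/(2πi)) ∫_{s-ik}^{s+ik} π^{-v/2} Γ(v/2) Q(v,a) x^{v-1} dv`,
parametrized along the vertical segment `v = s + iu`, `-k ≤ u ≤ k`. -/
noncomputable def Ixk (x : ℂ) (k : ℝ) (s : ℂ) (a : ℝ) : ℂ :=
  (1 / (2 * Real.pi * Complex.I)) *
    (Complex.I * ∫ u in (-k)..k,
      (Real.pi : ℂ) ^ (-(s + Complex.I * u) / 2) * Complex.Gamma ((s + Complex.I * u) / 2) *
        Qzeta (s + Complex.I * u) a * x ^ (s + Complex.I * u - 1))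

section
open Complex MeasureTheory

open FourierTransform SchwartzMap in
lemma plancherel_aux (f : ℝ → ℂ) (h1 : Integrable f) (h2 : MemLp f 2) :
    ∫ ξ, ‖𝓕 f ξ‖ ^ 2 = ∫ y, ‖f y‖ ^ 2 := by
  set g : Lp (α := ℝ) ℂ 2 volume := h2.toLp f with hg
  have hgf : g =ᵐ[volume] f := h2.coeFn_toLp
  have hcont : Continuous (𝓕 f) :=
    VectorFourier.fourierIntegral_continuous (L := innerₗ ℝ) Real.continuous_fourierChar
      (by exact continuous_inner) h1
  have key : ∀ᵐ x, (𝓕 f) x = ((𝓕 g : Lp (α := ℝ) ℂ 2 volume) : ℝ → ℂ) x := by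
    refine ae_eq_of_integral_contDiff_smul_eq hcont.locallyIntegrable
      ((Lp.memLp _).locallyIntegrable (by norm_num)) ?_
    intro φ hφ hφc
    have hφ' : ContDiff ℝ (↑(⊤ : ℕ∞)) (fun x => (φ x : ℂ)) := Complex.ofRealCLM.contDiff.comp hφ
    have hφc' : HasCompactSupport (fun x => (φ x : ℂ)) := hφc.comp_left (g := fun x : ℝ => (x : ℂ)) (by simp)
    set ψ : 𝓢(ℝ, ℂ) := hφc'.toSchwartzMap hφ' with hψ
    have hψv : ∀ x, ψ x = (φ x : ℂ) := fun x => rfl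
    have e1 := congrArg (fun T => T ψ) (Lp.fourier_toTemperedDistribution_eq g)
    simp only [TemperedDistribution.fourier_apply, Lp.toTemperedDistribution_apply] at e1
    have e2 : ∫ x, (𝓕 f) x • ψ x = ∫ x, f x • (𝓕 (ψ : ℝ → ℂ)) x :=
      VectorFourier.integral_fourierIntegral_smul_eq_flip (L := innerₗ ℝ) Real.continuous_fourierChar
        (by exact continuous_inner) h1 ψ.integrable |>.trans (by rw [flip_innerₗ]; rfl)
    calc ∫ x, φ x • (𝓕 f) x = ∫ x, (𝓕 f) x • ψ x := by
          congr 1; ext x; rw [hψv, smul_eq_mul, mul_comm]; rfl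
      _ = ∫ x, (𝓕 ψ) x • g x := by
          rw [e2]
          refine integral_congr_ae ?_
          filter_upwards [hgf] with x hx
          rw [hx, SchwartzMap.fourier_coe, smul_eq_mul, smul_eq_mul, mul_comm]
      _ = _ := by
          rw [e1]; rfl
  have hn := congrArg (fun x => x ^ 2) (Lp.norm_fourier_eq g)
  have h2n : ∀ u : Lp (α := ℝ) ℂ 2 volume, ‖u‖ ^ 2 = ∫ x, ‖u x‖ ^ 2 := by
    intro u
    have := L2.inner_def (𝕜 := ℂ) u u
    rw [inner_self_eq_norm_sq_to_K] at this
    have h3 : ∫ a, inner ℂ (u a) (u a) = ((∫ x, ‖u x‖ ^ 2 : ℝ) : ℂ) := by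
      rw [← integral_complex_ofReal]
      congr 1; ext x; rw [inner_self_eq_norm_sq_to_K]; simp
    rw [h3] at this
    exact Complex.ofReal_injective (by rw [← this]; push_cast; rfl)
  rw [h2n, h2n] at hn
  have e1 : ∫ y, ‖g y‖ ^ 2 = ∫ y, ‖f y‖ ^ 2 :=
    integral_congr_ae (hgf.mono fun x hx => by simp only; rw [hx])
  have e2 : ∫ y, ‖𝓕 f y‖ ^ 2 = ∫ y, ‖(𝓕 g : Lp (α := ℝ) ℂ 2 volume) y‖ ^ 2 :=
    integral_congr_ae (key.mono fun x hx => by simp only; rw [hx])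
  rw [e2, hn, e1]

end

section
open Complex MeasureTheory

noncomputable def pk (k y : ℝ) : ℝ := 32 * k ^ 2 / (4 + k ^ 2 * y ^ 2)

lemma pk_nonneg (k y : ℝ) : 0 ≤ pk k y := by unfold pk; positivity

lemma pk_le (k y : ℝ) : pk k y ≤ 8 * k ^ 2 := by
  unfold pk
  rw [div_le_iff₀ (by positivity)]
  nlinarith [sq_nonneg (k * y), sq_nonneg k, mul_nonneg (sq_nonneg k) (sq_nonneg (k * y))]

lemma pk_continuous (k : ℝ) : Continuous (pk k) := by
  unfold pk
  refine Continuous.div (by fun_prop) (by fun_prop) (fun y => by positivity)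

lemma pk_hasDerivAt (k y : ℝ) :
    HasDerivAt (pk k) (pk k y * (-(2 * k ^ 2 * y / (4 + k ^ 2 * y ^ 2)))) y := by
  have h : HasDerivAt (fun y : ℝ => 4 + k ^ 2 * y ^ 2) (k ^ 2 * (2 * y)) y := by
    simpa using ((hasDerivAt_pow 2 y).const_mul (k ^ 2)).const_add 4
  have h0 : (4 + k ^ 2 * y ^ 2) ≠ 0 := by positivity
  refine ((hasDerivAt_const y (32 * k ^ 2)).div h h0).congr_deriv ?_
  unfold pk; field_simp; ring

lemma pk_eq (k : ℝ) (hk : 0 < k) (y : ℝ) : pk k y = 8 * k ^ 2 * (1 + (k / 2 * y) ^ 2)⁻¹ := by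
  unfold pk
  have : 4 + k ^ 2 * y ^ 2 = 4 * (1 + (k / 2 * y) ^ 2) := by ring
  rw [this]
  have h0 : (1 + (k / 2 * y) ^ 2) ≠ 0 := by positivity
  field_simp; ring

lemma pk_integrable (k : ℝ) (hk : 0 < k) : Integrable (pk k) := by
  have : pk k = fun y => 8 * k ^ 2 * (1 + (k / 2 * y) ^ 2)⁻¹ := funext (pk_eq k hk)
  rw [this]
  exact ((integrable_inv_one_add_sq).comp_mul_left' (by positivity)).const_mul _

lemma pk_integral (k : ℝ) (hk : 0 < k) : ∫ y, pk k y = 16 * Real.pi * k := by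
  simp_rw [pk_eq k hk]
  rw [integral_const_mul, Measure.integral_comp_mul_left (fun y : ℝ => (1 + y ^ 2)⁻¹),
    integral_univ_inv_one_add_sq, abs_of_pos (by positivity), smul_eq_mul]
  field_simp; ring

lemma pk_integral_Ioi (k : ℝ) (hk : 0 < k) : ∫ y in Set.Ioi 0, pk k y ≤ 16 * Real.pi * k := by
  rw [← pk_integral k hk]
  exact setIntegral_le_integral (pk_integrable k hk) (Filter.Eventually.of_forall (pk_nonneg k))

lemma expexp_integrable (α : ℝ) (hα : 0 < α) :
    IntegrableOn (fun y : ℝ => Real.exp y * Real.exp (-α * Real.exp y)) (Set.Ioi 0) := by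
  have hd : ∀ y : ℝ, HasDerivAt (fun y : ℝ => -(1 / α) * Real.exp (-α * Real.exp y))
      (Real.exp y * Real.exp (-α * Real.exp y)) y := by
    intro y
    refine ((((Real.hasDerivAt_exp y).const_mul (-α)).exp).const_mul (-(1 / α))).congr_deriv ?_
    field_simp
  refine integrableOn_Ioi_deriv_of_nonneg (l := 0) (hd 0).continuousAt.continuousWithinAt
    (fun y _ => hd y) (fun y _ => by positivity) ?_
  have : Filter.Tendsto (fun y : ℝ => -α * Real.exp y) Filter.atTop Filter.atBot :=
    (Real.tendsto_exp_atTop).const_mul_atTop_of_neg (by linarith)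
  simpa using (Real.tendsto_exp_atBot.comp this).const_mul (-(1 / α))

/-- the basic integrand -/
noncomputable def Jint (k α β y : ℝ) : ℂ :=
  ((pk k y * Real.exp (y / 2) : ℝ) : ℂ) * Complex.exp (-(α + β * I) * Real.exp y)

lemma Jint_norm (k α β y : ℝ) :
    ‖Jint k α β y‖ = pk k y * Real.exp (y / 2) * Real.exp (-α * Real.exp y) := by
  unfold Jint
  rw [norm_mul, Complex.norm_real, Real.norm_of_nonneg (mul_nonneg (pk_nonneg k y) (by positivity)),
    Complex.norm_exp]
  congr 2
  rw [re_mul_ofReal]; simp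

lemma Jint_continuous (k α β : ℝ) : Continuous (Jint k α β) := by
  unfold Jint
  have := pk_continuous k
  fun_prop

lemma Jint_integrable (k α β : ℝ) (hα : 0 < α) : IntegrableOn (Jint k α β) (Set.Ioi 0) := by
  refine Integrable.mono' ((expexp_integrable α hα).const_mul (8 * k ^ 2))
    (Jint_continuous k α β).aestronglyMeasurable ?_
  refine (ae_restrict_iff' measurableSet_Ioi).2 (Filter.Eventually.of_forall fun y hy => ?_)
  rw [Jint_norm, mul_assoc]
  have : Real.exp (y / 2) ≤ Real.exp y := Real.exp_le_exp.2 (by simp at hy; linarith)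
  have := pk_le k y
  have := pk_nonneg k y
  gcongr

lemma Jint_bound (k α β : ℝ) (hα : 0 < α) (hβ : β ≠ 0) :
    ‖∫ y in Set.Ioi 0, Jint k α β y‖ ≤ 16 * k ^ 2 * Real.exp (-α) / |β| := by
  set V : ℝ → ℝ := fun y => pk k y * (Real.exp (-(y / 2)) * Real.exp (-α * Real.exp y)) with hV
  set V' : ℝ → ℝ := fun y =>
    V y * (-(2 * k ^ 2 * y / (4 + k ^ 2 * y ^ 2) + 1 / 2 + α * Real.exp y)) with hV'
  set E : ℝ → ℂ := fun y => Complex.exp (-(β * I) * Real.exp y) with hE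
  have hVnn : ∀ y, 0 ≤ V y := fun y => mul_nonneg (pk_nonneg k y) (by positivity)
  have hVd : ∀ y, HasDerivAt V (V' y) y := by
    intro y
    have h1 : HasDerivAt (fun y : ℝ => Real.exp (-(y / 2))) (Real.exp (-(y / 2)) * (-(1 / 2))) y :=
      (((hasDerivAt_id y).div_const 2).neg).exp
    have h2 := ((Real.hasDerivAt_exp y).const_mul (-α)).exp
    refine ((pk_hasDerivAt k y).mul (h1.mul h2)).congr_deriv ?_
    simp only [hV', hV, Pi.mul_apply]
    ring
  have hV'np : ∀ y ∈ Set.Ioi (0 : ℝ), V' y ≤ 0 := by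
    intro y hy
    have hy : 0 < y := hy
    refine mul_nonpos_of_nonneg_of_nonpos (hVnn y) ?_
    have : 0 ≤ 2 * k ^ 2 * y / (4 + k ^ 2 * y ^ 2) + 1 / 2 + α * Real.exp y := by positivity
    linarith
  have hEd : ∀ y, HasDerivAt E (-(β * I) * Real.exp y * E y) y := by
    intro y
    have h1 : HasDerivAt (fun y : ℝ => ((Real.exp y : ℝ) : ℂ)) (Real.exp y : ℝ) y :=
      (Real.hasDerivAt_exp y).ofReal_comp
    refine ((h1.const_mul (-(β * I))).cexp).congr_deriv ?_
    simp only [hE]; ring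
  have hEn : ∀ y, ‖E y‖ = 1 := by
    intro y
    simp only [hE, Complex.norm_exp]
    rw [re_mul_ofReal]; simp
  have hVle : ∀ y ∈ Set.Ioi (0 : ℝ), V y ≤ 8 * k ^ 2 * Real.exp (-α * Real.exp y) := by
    intro y hy
    have hy : 0 < y := hy
    have h1 : Real.exp (-(y / 2)) ≤ 1 := Real.exp_le_one_iff.2 (by linarith)
    calc V y ≤ 8 * k ^ 2 * (1 * Real.exp (-α * Real.exp y)) := by
          have := pk_le k y
          have := pk_nonneg k y
          simp only [hV]; gcongr
      _ = _ := by ring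
  have hVt : Filter.Tendsto V Filter.atTop (nhds 0) := by
    have : Filter.Tendsto (fun y : ℝ => -α * Real.exp y) Filter.atTop Filter.atBot :=
      (Real.tendsto_exp_atTop).const_mul_atTop_of_neg (by linarith)
    have h2 : Filter.Tendsto (fun y : ℝ => 8 * k ^ 2 * Real.exp (-α * Real.exp y))
        Filter.atTop (nhds 0) := by
      simpa using (Real.tendsto_exp_atBot.comp this).const_mul (8 * k ^ 2)
    refine tendsto_of_tendsto_of_tendsto_of_le_of_le' tendsto_const_nhds h2
      (Filter.Eventually.of_forall hVnn) ?_
    filter_upwards [Filter.eventually_gt_atTop 0] with y hy using hVle y hy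
  have hV'int : IntegrableOn V' (Set.Ioi 0) :=
    integrableOn_Ioi_deriv_of_nonpos (hVd 0).continuousAt.continuousWithinAt
      (fun y _ => hVd y) hV'np hVt
  have hV'val : ∫ y in Set.Ioi 0, V' y = 0 - V 0 :=
    integral_Ioi_of_hasDerivAt_of_nonpos (hVd 0).continuousAt.continuousWithinAt
      (fun y _ => hVd y) hV'np hVt
  have hβI : (-(β * I) : ℂ) ≠ 0 := by simp [hβ]
  have hJ : ∀ y, (V y : ℂ) * (-(β * I) * Real.exp y * E y) = -(β * I) * Jint k α β y := by
    intro y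
    simp only [hV, hE, Jint]
    have e1 : Real.exp (y / 2) = Real.exp (-(y / 2)) * Real.exp y := by
      rw [← Real.exp_add]; congr 1; ring
    rw [e1, show (-(α + β * I) * Real.exp y : ℂ) = ((-α * Real.exp y : ℝ) : ℂ) + -(β * I) * Real.exp y by
      push_cast; ring, Complex.exp_add, ← ofReal_exp (-α * Real.exp y)]
    push_cast
    ring
  have hEcont : Continuous E := continuous_iff_continuousAt.2 fun y => (hEd y).continuousAt
  have hV'E : IntegrableOn (fun y => (V' y : ℂ) * E y) (Set.Ioi 0) := by
    refine Integrable.mul_bdd (c := 1) hV'int.ofReal hEcont.aestronglyMeasurable ?_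
    exact Filter.Eventually.of_forall fun y => (hEn y).le
  have hibp := integral_Ioi_mul_deriv_eq_deriv_mul (a := 0) (u := fun y => (V y : ℂ)) (v := E)
    (u' := fun y => (V' y : ℂ)) (v' := fun y => -(β * I) * Real.exp y * E y)
    (a' := (V 0 : ℂ) * E 0) (b' := 0)
    (fun y _ => (hVd y).ofReal_comp) (fun y _ => hEd y)
    (by
      have : (fun y => (V y : ℂ)) * (fun y => -(β * I) * Real.exp y * E y)
        = fun y => -(β * I) * Jint k α β y := funext hJ
      rw [this]
      exact (Jint_integrable k α β hα).const_mul _)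
    hV'E
    (by
      have : ContinuousAt (fun y => (V y : ℂ) * E y) 0 :=
        ((hVd 0).ofReal_comp.continuousAt).mul (hEd 0).continuousAt
      exact this.continuousWithinAt)
    (by
      rw [tendsto_zero_iff_norm_tendsto_zero]
      refine hVt.congr fun y => ?_
      simp [hEn, abs_of_nonneg (hVnn y)])
  simp only [hJ] at hibp
  rw [integral_const_mul] at hibp
  have hn := congrArg norm hibp
  rw [norm_mul, norm_neg, norm_mul, Complex.norm_I, Complex.norm_real, mul_one, Real.norm_eq_abs] at hn
  rw [le_div_iff₀ (abs_pos.2 hβ), mul_comm, hn]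
  have hV0 : V 0 = 8 * k ^ 2 * Real.exp (-α) := by
    simp [hV, pk]; ring
  have hb : ‖∫ y in Set.Ioi 0, (V' y : ℂ) * E y‖ ≤ V 0 := by
    refine (norm_integral_le_integral_norm _).trans ?_
    have : ∫ y in Set.Ioi 0, ‖(V' y : ℂ) * E y‖ = ∫ y in Set.Ioi 0, -V' y := by
      refine setIntegral_congr_fun measurableSet_Ioi fun y hy => ?_
      simp only [norm_mul, hEn, mul_one, Complex.norm_real, Real.norm_eq_abs]
      exact abs_of_nonpos (hV'np y hy)
    rw [this, integral_neg, hV'val]; simp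
  calc ‖0 - (V 0 : ℂ) * E 0 - ∫ y in Set.Ioi 0, (V' y : ℂ) * E y‖
      ≤ ‖0 - (V 0 : ℂ) * E 0‖ + ‖∫ y in Set.Ioi 0, (V' y : ℂ) * E y‖ := norm_sub_le _ _
    _ ≤ V 0 + V 0 := by
        gcongr
        simp [hEn, abs_of_nonneg (hVnn 0)]
    _ = _ := by rw [hV0]; ring

end

section
open Complex MeasureTheory

lemma exp_neg_le_rpow (u : ℝ) (hu : 0 < u) (r : ℝ) (hr : 0 ≤ r) (hr1 : r ≤ 1) :
    Real.exp (-u) ≤ u ^ (-r) := by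
  rw [Real.rpow_def_of_pos hu]
  apply Real.exp_le_exp.2
  have h := Real.log_le_sub_one_of_pos hu
  nlinarith

/-- Gaussian sums -/
lemma gauss_sum_le (b : ℝ) (hb : 0 < b) (q : ℝ) (hq : 0 < q) (N : ℕ) :
    ∑ n ∈ Finset.range N, Real.exp (-(n + b) ^ 2 * q) ≤ (1 / b + 1) / Real.sqrt q := by
  have hsq : 0 < Real.sqrt q := Real.sqrt_pos.2 hq
  have h0 : Real.exp (-(b ^ 2 * q)) ≤ 1 / b / Real.sqrt q := by
    refine (exp_neg_le_rpow (b ^ 2 * q) (by positivity) (1 / 2) (by norm_num) (by norm_num)).trans ?_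
    rw [Real.rpow_neg (by positivity), ← Real.sqrt_eq_rpow, Real.sqrt_mul (by positivity),
      Real.sqrt_sq hb.le]
    apply le_of_eq; field_simp
  have hN : ∑ n ∈ Finset.range N, Real.exp (-(n + b) ^ 2 * q) ≤
      ∑ n ∈ Finset.range (N + 1), Real.exp (-(n + b) ^ 2 * q) :=
    Finset.sum_le_sum_of_subset_of_nonneg (Finset.range_mono (Nat.le_succ N))
      (fun _ _ _ => by positivity)
  refine hN.trans ?_
  rw [Finset.sum_range_succ']
  have h1 : ∑ n ∈ Finset.range N, Real.exp (-((n + 1 : ℕ) + b) ^ 2 * q) ≤ 1 / Real.sqrt q := by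
    have h2 : ∑ n ∈ Finset.range N, Real.exp (-((n + 1 : ℕ) + b) ^ 2 * q) ≤
        ∑ n ∈ Finset.range N, (fun u : ℝ => Real.exp (-q * u ^ 2)) (0 + (n + 1 : ℕ)) := by
      refine Finset.sum_le_sum fun n _ => ?_
      apply Real.exp_le_exp.2
      push_cast
      have : 0 ≤ (n : ℝ) := Nat.cast_nonneg n
      nlinarith [mul_nonneg hq.le (by positivity : 0 ≤ 2 * ((n : ℝ) + 1) * b + b ^ 2)]
    have h3 := AntitoneOn.sum_le_integral (x₀ := (0 : ℝ)) (a := N)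
      (f := fun u : ℝ => Real.exp (-q * u ^ 2)) (by
        intro u hu v hv huv
        apply Real.exp_le_exp.2
        have hu0 : 0 ≤ u := hu.1
        have : u ^ 2 ≤ v ^ 2 := by gcongr
        nlinarith)
    refine h2.trans (h3.trans ?_)
    rw [intervalIntegral.integral_of_le (by positivity)]
    have h4 : ∫ u in Set.Ioc (0 : ℝ) (0 + N), Real.exp (-q * u ^ 2) ≤
        ∫ u in Set.Ioi (0 : ℝ), Real.exp (-q * u ^ 2) :=
      setIntegral_mono_set (integrable_exp_neg_mul_sq hq).integrableOn
        (Filter.Eventually.of_forall fun _ => by positivity)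
        (Filter.Eventually.of_forall fun u hu => hu.1)
    refine h4.trans ?_
    rw [integral_gaussian_Ioi, Real.sqrt_div Real.pi_pos.le, div_div, mul_comm, ← div_div]
    gcongr
    have : Real.sqrt Real.pi ≤ 2 := by
      rw [Real.sqrt_le_left (by norm_num)]; linarith [Real.pi_le_four]
    linarith
  have h5 : Real.exp (-((0 : ℕ) + b) ^ 2 * q) ≤ 1 / b / Real.sqrt q := by
    refine le_trans (le_of_eq ?_) h0
    congr 1; push_cast; ring
  calc _ ≤ 1 / Real.sqrt q + 1 / b / Real.sqrt q := add_le_add h1 h5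
    _ = _ := by ring

noncomputable def aj (j : ℕ) : ℝ := (j : ℝ) ^ (-(5 / 4) : ℝ)

lemma aj_nonneg (j : ℕ) : 0 ≤ aj j := by unfold aj; positivity

lemma aj_zero : aj 0 = 0 := by
  unfold aj; rw [Nat.cast_zero, Real.zero_rpow (by norm_num)]

lemma aj_summable : Summable aj := by
  unfold aj
  exact Real.summable_nat_rpow.2 (by norm_num)

noncomputable def Zc : ℝ := ∑' j, aj j

lemma Zc_nonneg : 0 ≤ Zc := tsum_nonneg aj_nonneg

lemma aj_sum_sub (m N : ℕ) : ∑ n ∈ Finset.range N, aj (m - n) ≤ Zc := by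
  have h1 : ∑ n ∈ Finset.range N, aj (m - n) ≤ ∑ n ∈ Finset.range (m + 1), aj (m - n) := by
    calc ∑ n ∈ Finset.range N, aj (m - n)
        ≤ ∑ n ∈ Finset.range (max N (m + 1)), aj (m - n) :=
          Finset.sum_le_sum_of_subset_of_nonneg (Finset.range_mono (le_max_left _ _))
            (fun _ _ _ => aj_nonneg _)
      _ = ∑ n ∈ Finset.range (m + 1), aj (m - n) := by
          symm
          refine Finset.sum_subset (Finset.range_mono (le_max_right _ _)) ?_
          intro n _ hn
          rw [Finset.mem_range, not_lt] at hn
          rw [Nat.sub_eq_zero_of_le (by omega), aj_zero]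
  refine h1.trans ?_
  have := Finset.sum_range_reflect aj (m + 1)
  simp only [Nat.add_sub_cancel] at this
  rw [this]
  exact aj_summable.sum_le_tsum _ (fun _ _ => aj_nonneg _)

lemma aj_double (N : ℕ) :
    ∑ m ∈ Finset.range N, ∑ n ∈ Finset.range N, aj (m - n) * aj m ≤ Zc ^ 2 := by
  simp_rw [← Finset.sum_mul]
  calc _ ≤ ∑ m ∈ Finset.range N, Zc * aj m := by
        gcongr with m _
        · exact aj_nonneg _
        · exact aj_sum_sub m N
    _ = Zc * ∑ m ∈ Finset.range N, aj m := by rw [Finset.mul_sum]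
    _ ≤ Zc * Zc := by
        gcongr
        · exact Zc_nonneg
        · exact aj_summable.sum_le_tsum _ (fun _ _ => aj_nonneg _)
    _ = _ := by ring

lemma offdiag_term (b : ℝ) (hb : 0 < b) (s : ℝ) (hs : 0 < s) (c0 : ℝ) (hc0 : 1 / 2 ≤ c0) (k : ℝ)
    (m n : ℕ) (hmn : n < m) (α β : ℝ)
    (hα : α = Real.pi * ((m + b) ^ 2 + (n + b) ^ 2) * s)
    (hβ : |β| = Real.pi * ((m + b) ^ 2 - (n + b) ^ 2) * c0) :
    ‖∫ y in Set.Ioi 0, Jint k α β y‖ ≤ 16 * k ^ 2 * s ^ (-(1 / 4) : ℝ) * (aj (m - n) * aj m) := by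
  obtain ⟨j, rfl⟩ := Nat.exists_eq_add_of_lt hmn
  have hj : n + j + 1 - n = j + 1 := by omega
  rw [hj]
  set M : ℝ := ((n + j + 1 : ℕ) : ℝ) with hM
  set J : ℝ := ((j + 1 : ℕ) : ℝ) with hJ
  have hn0 : 0 ≤ (n : ℝ) := Nat.cast_nonneg n
  have hJ0 : 0 < J := by positivity
  have hM0 : 0 < M := by positivity
  have hMJ : M = n + J := by rw [hM, hJ]; push_cast; ring
  have hJM : J ≤ M := by linarith
  have hpi := Real.pi_gt_three
  have hβl : J * M ≤ |β| := by
    rw [hβ]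
    have h1 : (M + b) ^ 2 - (n + b) ^ 2 = J * (M + n + 2 * b) := by rw [hMJ]; ring
    rw [h1]
    have h2 : J * M ≤ J * (M + n + 2 * b) := by gcongr; linarith
    have h3 : 1 ≤ Real.pi * c0 := by nlinarith
    have h4 : 0 ≤ J * (M + n + 2 * b) := by positivity
    nlinarith
  have hαl : s * M ^ 2 ≤ α := by
    rw [hα]
    have h1 : M ^ 2 ≤ (M + b) ^ 2 + (n + b) ^ 2 := by nlinarith [sq_nonneg (n + b), mul_pos hM0 hb]
    have h4 : 0 ≤ (M + b) ^ 2 + (n + b) ^ 2 := by positivity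
    calc s * M ^ 2 ≤ s * (Real.pi * ((M + b) ^ 2 + (n + b) ^ 2)) := by
          gcongr; nlinarith
      _ = _ := by ring
  have hαp : 0 < α := lt_of_lt_of_le (by positivity) hαl
  have hβp : 0 < |β| := lt_of_lt_of_le (by positivity) hβl
  refine (Jint_bound k α β hαp (abs_pos.1 hβp)).trans ?_
  have he : Real.exp (-α) ≤ s ^ (-(1 / 4) : ℝ) * M ^ (-(1 / 2) : ℝ) := by
    calc Real.exp (-α) ≤ Real.exp (-(s * M ^ 2)) := Real.exp_le_exp.2 (by linarith)
      _ ≤ (s * M ^ 2) ^ (-(1 / 4) : ℝ) :=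
        exp_neg_le_rpow _ (by positivity) _ (by norm_num) (by norm_num)
      _ = _ := by
        rw [Real.mul_rpow hs.le (by positivity), ← Real.rpow_natCast M 2, ← Real.rpow_mul hM0.le]
        norm_num
  have ha : M ^ (-(1 / 2) : ℝ) / (J * M) ≤ aj (j + 1) * aj (n + j + 1) := by
    unfold aj
    rw [← hM, ← hJ]
    have e1 : M ^ (-(1 / 2) : ℝ) = M ^ (-(5 / 4) : ℝ) * M ^ (-(1 / 4) : ℝ) * M := by
      nth_rewrite 4 [← Real.rpow_one M]
      rw [← Real.rpow_add hM0, ← Real.rpow_add hM0]; norm_num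
    have e2 : J ^ (-(5 / 4) : ℝ) = J ^ (-(1 / 4) : ℝ) / J := by
      rw [← Real.rpow_sub_one hJ0.ne']; norm_num
    have e3 : M ^ (-(1 / 4) : ℝ) ≤ J ^ (-(1 / 4) : ℝ) :=
      Real.rpow_le_rpow_of_nonpos hJ0 hJM (by norm_num)
    rw [e1, e2]
    calc M ^ (-(5 / 4) : ℝ) * M ^ (-(1 / 4) : ℝ) * M / (J * M)
        = M ^ (-(5 / 4) : ℝ) * M ^ (-(1 / 4) : ℝ) / J := by field_simp
      _ ≤ M ^ (-(5 / 4) : ℝ) * J ^ (-(1 / 4) : ℝ) / J := by gcongr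
      _ = _ := by ring
  calc 16 * k ^ 2 * Real.exp (-α) / |β|
      ≤ 16 * k ^ 2 * (s ^ (-(1 / 4) : ℝ) * M ^ (-(1 / 2) : ℝ)) / (J * M) := by gcongr
    _ = 16 * k ^ 2 * s ^ (-(1 / 4) : ℝ) * (M ^ (-(1 / 2) : ℝ) / (J * M)) := by ring
    _ ≤ _ := by gcongr

end

section
open Complex MeasureTheory

noncomputable def tm (c : ℕ → ℂ) (b s c0 : ℝ) (y : ℝ) (n : ℕ) : ℂ :=
  c n * Complex.exp (-(Real.pi * (n + b) ^ 2 * (s + c0 * I) * Real.exp y))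

lemma normsq_expand (c : ℕ → ℂ) (b s c0 k : ℝ) (N : ℕ) (y : ℝ) :
    ((pk k y * Real.exp (y / 2) * ‖∑ n ∈ Finset.range N, tm c b s c0 y n‖ ^ 2 : ℝ) : ℂ) =
    ∑ m ∈ Finset.range N, ∑ n ∈ Finset.range N, c m * (starRingEnd ℂ) (c n) *
      Jint k (Real.pi * ((m + b) ^ 2 + (n + b) ^ 2) * s)
        (Real.pi * ((m + b) ^ 2 - (n + b) ^ 2) * c0) y := by
  rw [ofReal_mul, ofReal_pow, ← Complex.mul_conj', map_sum, Finset.sum_mul_sum, Finset.mul_sum]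
  refine Finset.sum_congr rfl fun m _ => ?_
  rw [Finset.mul_sum]
  refine Finset.sum_congr rfl fun n _ => ?_
  unfold tm Jint
  rw [map_mul, ← Complex.exp_conj]
  have : Complex.exp (-((((Real.pi * ((m + b) ^ 2 + (n + b) ^ 2) * s : ℝ) : ℂ)) +
      ((Real.pi * ((m + b) ^ 2 - (n + b) ^ 2) * c0 : ℝ) : ℂ) * I) * Real.exp y) =
      Complex.exp (-(Real.pi * (m + b) ^ 2 * (s + c0 * I) * Real.exp y)) *
      Complex.exp ((starRingEnd ℂ) (-(Real.pi * (n + b) ^ 2 * (s + c0 * I) * Real.exp y))) := by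
    rw [← Complex.exp_add]
    congr 1
    simp only [map_neg, map_mul, map_add, map_pow, conj_ofReal, conj_I, map_natCast]
    push_cast
    ring
  rw [this]
  ring

lemma diag_sum (b : ℝ) (hb : 0 < b) (s : ℝ) (hs : 0 < s) (k : ℝ) (hk : 0 < k) (N : ℕ) (β : ℕ → ℝ) :
    ∑ n ∈ Finset.range N,
      ‖∫ y in Set.Ioi 0, Jint k (Real.pi * ((n + b) ^ 2 + (n + b) ^ 2) * s) (β n) y‖ ≤
    16 * Real.pi * (1 / b + 1) * k / Real.sqrt s := by
  have hα : ∀ n : ℕ, 0 < Real.pi * (((n : ℝ) + b) ^ 2 + (n + b) ^ 2) * s := fun n => by positivity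
  have hss : 0 < Real.sqrt s := Real.sqrt_pos.2 hs
  calc _ ≤ ∑ n ∈ Finset.range N, ∫ y in Set.Ioi 0,
        ‖Jint k (Real.pi * ((n + b) ^ 2 + (n + b) ^ 2) * s) (β n) y‖ :=
        Finset.sum_le_sum fun n _ => norm_integral_le_integral_norm _
    _ = ∫ y in Set.Ioi 0, ∑ n ∈ Finset.range N,
        ‖Jint k (Real.pi * ((n + b) ^ 2 + (n + b) ^ 2) * s) (β n) y‖ := by
        rw [integral_finsetSum]
        exact fun n _ => (Jint_integrable k _ _ (hα n)).norm
    _ ≤ ∫ y in Set.Ioi 0, pk k y * ((1 / b + 1) / Real.sqrt s) := by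
        refine setIntegral_mono_on ?_ ?_ measurableSet_Ioi ?_
        · exact integrable_finsetSum _ fun n _ => (Jint_integrable k _ _ (hα n)).norm
        · exact ((pk_integrable k hk).mul_const _).integrableOn
        · intro y _
          simp_rw [Jint_norm, ← Finset.mul_sum]
          rw [mul_assoc]
          refine mul_le_mul_of_nonneg_left ?_ (pk_nonneg k y)
          have hq : 0 < 2 * Real.pi * s * Real.exp y := by have := Real.pi_pos; positivity
          have hg := gauss_sum_le b hb (2 * Real.pi * s * Real.exp y) hq N
          have e : ∀ n : ℕ, Real.exp (-(Real.pi * (((n : ℝ) + b) ^ 2 + (n + b) ^ 2) * s) * Real.exp y)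
              = Real.exp (-(n + b) ^ 2 * (2 * Real.pi * s * Real.exp y)) := by
            intro n; congr 1; ring
          simp_rw [e]
          have h2 : Real.sqrt s * Real.exp (y / 2) ≤ Real.sqrt (2 * Real.pi * s * Real.exp y) := by
            apply Real.le_sqrt_of_sq_le
            rw [mul_pow, Real.sq_sqrt hs.le, ← Real.exp_nat_mul]
            have : ((2 : ℕ) : ℝ) * (y / 2) = y := by push_cast; ring
            rw [this]
            have := Real.pi_gt_three
            have h3 : 0 < s * Real.exp y := by positivity
            nlinarith
          calc _ ≤ Real.exp (y / 2) * ((1 / b + 1) / (Real.sqrt s * Real.exp (y / 2))) := by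
                gcongr
                exact hg.trans (by gcongr)
            _ = _ := by field_simp
    _ = (∫ y in Set.Ioi 0, pk k y) * ((1 / b + 1) / Real.sqrt s) := by rw [integral_mul_const]
    _ ≤ (16 * Real.pi * k) * ((1 / b + 1) / Real.sqrt s) := by
        gcongr; exact pk_integral_Ioi k hk
    _ = _ := by ring

noncomputable def bnd (b s k : ℝ) : ℝ :=
  64 * Real.pi * (1 / b + 1) * k / Real.sqrt s + 128 * Zc ^ 2 * k ^ 2 * s ^ (-(1 / 4) : ℝ)

lemma finite_bound (c : ℕ → ℂ) (hc : ∀ n, ‖c n‖ ≤ 2) (b : ℝ) (hb : 0 < b) (s : ℝ) (hs : 0 < s)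
    (c0 : ℝ) (hc0 : 1 / 2 ≤ c0) (k : ℝ) (hk : 0 < k) (N : ℕ) :
    IntegrableOn (fun y => pk k y * Real.exp (y / 2) *
      ‖∑ n ∈ Finset.range N, tm c b s c0 y n‖ ^ 2) (Set.Ioi 0) ∧
    ∫ y in Set.Ioi 0, pk k y * Real.exp (y / 2) *
      ‖∑ n ∈ Finset.range N, tm c b s c0 y n‖ ^ 2 ≤ bnd b s k := by
  set A : ℕ → ℕ → ℝ := fun m n => Real.pi * ((m + b) ^ 2 + (n + b) ^ 2) * s with hA
  set B : ℕ → ℕ → ℝ := fun m n => Real.pi * ((m + b) ^ 2 - (n + b) ^ 2) * c0 with hB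
  have hApos : ∀ m n, 0 < A m n := fun m n => by simp only [hA]; positivity
  have hInt : ∀ m n, IntegrableOn (fun y => c m * (starRingEnd ℂ) (c n) * Jint k (A m n) (B m n) y)
      (Set.Ioi 0) := fun m n => (Jint_integrable k _ _ (hApos m n)).const_mul _
  have hcont : Continuous (fun y => pk k y * Real.exp (y / 2) *
      ‖∑ n ∈ Finset.range N, tm c b s c0 y n‖ ^ 2) := by
    have := pk_continuous k
    unfold tm
    fun_prop
  have hIc : IntegrableOn (fun y => ((pk k y * Real.exp (y / 2) *
      ‖∑ n ∈ Finset.range N, tm c b s c0 y n‖ ^ 2 : ℝ) : ℂ)) (Set.Ioi 0) := by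
    simp_rw [normsq_expand]
    exact integrable_finsetSum _ fun m _ => integrable_finsetSum _ fun n _ => hInt m n
  refine ⟨hIc.re, ?_⟩
  have e1 : ((∫ y in Set.Ioi 0, pk k y * Real.exp (y / 2) *
      ‖∑ n ∈ Finset.range N, tm c b s c0 y n‖ ^ 2 : ℝ) : ℂ) =
      ∑ m ∈ Finset.range N, ∑ n ∈ Finset.range N, c m * (starRingEnd ℂ) (c n) *
        ∫ y in Set.Ioi 0, Jint k (A m n) (B m n) y := by
    rw [← integral_complex_ofReal]
    simp_rw [normsq_expand]
    rw [integral_finsetSum _ (fun m _ => integrable_finsetSum _ fun n _ => hInt m n)]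
    refine Finset.sum_congr rfl fun m _ => ?_
    rw [integral_finsetSum _ (fun n _ => hInt m n)]
    refine Finset.sum_congr rfl fun n _ => ?_
    rw [integral_const_mul]
  set J : ℕ → ℕ → ℝ := fun m n => ‖∫ y in Set.Ioi 0, Jint k (A m n) (B m n) y‖ with hJ
  have hJ0 : ∀ m n, 0 ≤ J m n := fun m n => norm_nonneg _
  set Q : ℝ := 16 * k ^ 2 * s ^ (-(1 / 4) : ℝ) with hQ
  have hQ0 : 0 ≤ Q := by positivity
  have hterm : ∀ m n, J m n ≤ (if m = n then J m m else 0) +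
      (Q * (aj (m - n) * aj m) + Q * (aj (n - m) * aj n)) := by
    intro m n
    have p1 : 0 ≤ Q * (aj (m - n) * aj m) := mul_nonneg hQ0 (mul_nonneg (aj_nonneg _) (aj_nonneg _))
    have p2 : 0 ≤ Q * (aj (n - m) * aj n) := mul_nonneg hQ0 (mul_nonneg (aj_nonneg _) (aj_nonneg _))
    rcases lt_trichotomy m n with h | h | h
    · rw [if_neg h.ne]
      have hlt : (m : ℝ) < n := by exact_mod_cast h
      have := offdiag_term b hb s hs c0 hc0 k n m h (A m n) (B m n) (by simp only [hA]; ring) (by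
        simp only [hB]
        rw [abs_of_nonpos]
        · ring
        · have h1 : ((m : ℝ) + b) ^ 2 - (n + b) ^ 2 ≤ 0 := by
            have : ((m : ℝ) + b) ^ 2 ≤ (n + b) ^ 2 := by gcongr
            linarith
          exact mul_nonpos_of_nonpos_of_nonneg
            (mul_nonpos_of_nonneg_of_nonpos Real.pi_pos.le h1) (by linarith))
      linarith
    · subst h; rw [if_pos rfl]; linarith
    · rw [if_neg h.ne']
      have hlt : (n : ℝ) < m := by exact_mod_cast h
      have := offdiag_term b hb s hs c0 hc0 k m n h (A m n) (B m n) rfl (by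
        simp only [hB]
        rw [abs_of_nonneg]
        have h1 : 0 ≤ ((m : ℝ) + b) ^ 2 - (n + b) ^ 2 := by
            have : ((n : ℝ) + b) ^ 2 ≤ (m + b) ^ 2 := by gcongr
            linarith
        exact mul_nonneg (mul_nonneg Real.pi_pos.le h1) (by linarith))
      linarith
  have hsum : ∑ m ∈ Finset.range N, ∑ n ∈ Finset.range N, J m n ≤
      16 * Real.pi * (1 / b + 1) * k / Real.sqrt s + (Q * Zc ^ 2 + Q * Zc ^ 2) := by
    calc _ ≤ ∑ m ∈ Finset.range N, ∑ n ∈ Finset.range N, ((if m = n then J m m else 0) +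
      (Q * (aj (m - n) * aj m) + Q * (aj (n - m) * aj n))) :=
          Finset.sum_le_sum fun m _ => Finset.sum_le_sum fun n _ => hterm m n
      _ = ∑ m ∈ Finset.range N, J m m +
          (Q * ∑ m ∈ Finset.range N, ∑ n ∈ Finset.range N, aj (m - n) * aj m +
           Q * ∑ m ∈ Finset.range N, ∑ n ∈ Finset.range N, aj (n - m) * aj n) := by
          simp_rw [Finset.sum_add_distrib, Finset.mul_sum]
          congr 1
          refine Finset.sum_congr rfl fun m hm => ?_
          rw [Finset.sum_ite_eq, if_pos hm]
      _ ≤ _ := by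
          gcongr
          · exact diag_sum b hb s hs k hk N (fun n => B n n)
          · exact aj_double N
          · rw [Finset.sum_comm]; exact aj_double N
  have hle : ∫ y in Set.Ioi 0, pk k y * Real.exp (y / 2) *
      ‖∑ n ∈ Finset.range N, tm c b s c0 y n‖ ^ 2 ≤
      ∑ m ∈ Finset.range N, ∑ n ∈ Finset.range N, 4 * J m n := by
    refine (le_abs_self _).trans ?_
    rw [← Real.norm_eq_abs, ← Complex.norm_real, e1]
    refine (norm_sum_le _ _).trans (Finset.sum_le_sum fun m _ => ?_)
    refine (norm_sum_le _ _).trans (Finset.sum_le_sum fun n _ => ?_)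
    rw [norm_mul, norm_mul, RCLike.norm_conj]
    refine mul_le_mul_of_nonneg_right ?_ (hJ0 m n)
    nlinarith [hc m, hc n, norm_nonneg (c m), norm_nonneg (c n)]
  refine hle.trans ?_
  simp_rw [← Finset.mul_sum]
  calc _ ≤ 4 * (16 * Real.pi * (1 / b + 1) * k / Real.sqrt s + (Q * Zc ^ 2 + Q * Zc ^ 2)) := by
        gcongr
    _ = _ := by unfold bnd; rw [hQ]; ring

lemma family_bound (c : ℕ → ℂ) (hc : ∀ n, ‖c n‖ ≤ 2) (b : ℝ) (hb : 0 < b) (s : ℝ) (hs : 0 < s)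
    (c0 : ℝ) (hc0 : 1 / 2 ≤ c0) (k : ℝ) (hk : 0 < k) (f : ℝ → ℂ)
    (hf : ∀ y, HasSum (tm c b s c0 y) (f y)) :
    ∫⁻ y in Set.Ioi 0, ENNReal.ofReal (pk k y * Real.exp (y / 2) * ‖f y‖ ^ 2) ≤
      ENNReal.ofReal (bnd b s k) := by
  have hcont : ∀ N : ℕ, Continuous (fun y => pk k y * Real.exp (y / 2) *
      ‖∑ n ∈ Finset.range N, tm c b s c0 y n‖ ^ 2) := by
    intro N
    have := pk_continuous k
    unfold tm
    fun_prop
  have hlim : ∀ y, Filter.Tendsto (fun N => ENNReal.ofReal (pk k y * Real.exp (y / 2) *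
      ‖∑ n ∈ Finset.range N, tm c b s c0 y n‖ ^ 2)) Filter.atTop
      (nhds (ENNReal.ofReal (pk k y * Real.exp (y / 2) * ‖f y‖ ^ 2))) := by
    intro y
    exact ENNReal.tendsto_ofReal ((((hf y).tendsto_sum_nat).norm.pow 2).const_mul _)
  have e : ∀ y, ENNReal.ofReal (pk k y * Real.exp (y / 2) * ‖f y‖ ^ 2) =
      Filter.liminf (fun N => ENNReal.ofReal (pk k y * Real.exp (y / 2) *
      ‖∑ n ∈ Finset.range N, tm c b s c0 y n‖ ^ 2)) Filter.atTop := fun y => (hlim y).liminf_eq.symm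
  simp_rw [e]
  refine (lintegral_liminf_le fun N => (hcont N).measurable.ennreal_ofReal).trans ?_
  refine Filter.liminf_le_of_le (by isBoundedDefault) ?_
  intro x hx
  obtain ⟨N, hN⟩ := hx.exists
  refine hN.trans ?_
  obtain ⟨h1, h2⟩ := finite_bound c hc b hb s hs c0 hc0 k hk N
  rw [← ofReal_integral_eq_lintegral_ofReal h1 (Filter.Eventually.of_forall fun y =>
    mul_nonneg (mul_nonneg (pk_nonneg k y) (by positivity)) (by positivity))]
  exact ENNReal.ofReal_le_ofReal h2

end

section
open Complex MeasureTheory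

lemma integrableOn_rpow_exp (σ r : ℝ) (hσ : 0 < σ) (hr : 0 < r) :
    IntegrableOn (fun t : ℝ => t ^ (σ - 1) * Real.exp (-(r * t))) (Set.Ioi 0) := by
  have := integrableOn_rpow_mul_exp_neg_mul_rpow (s := σ - 1) (p := 1) (b := r) (by linarith)
    one_pos hr
  refine this.congr_fun (fun t _ => ?_) measurableSet_Ioi
  simp

lemma aesm_cpow_exp (s r : ℂ) :
    AEStronglyMeasurable (fun t : ℝ => (t : ℂ) ^ (s - 1) * cexp (-(r * t)))
      (volume.restrict (Set.Ioi 0)) := by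
  refine ContinuousOn.aestronglyMeasurable ?_ measurableSet_Ioi
  refine ContinuousOn.mul ?_ (by fun_prop)
  intro t ht
  refine ContinuousAt.continuousWithinAt ?_
  exact continuousAt_ofReal_cpow_const t _ (Or.inr (ne_of_gt ht))

lemma norm_cpow_exp (s r : ℂ) (t : ℝ) (ht : 0 < t) :
    ‖(t : ℂ) ^ (s - 1) * cexp (-(r * t))‖ = t ^ (s.re - 1) * Real.exp (-(r.re * t)) := by
  rw [norm_mul, norm_cpow_eq_rpow_re_of_pos ht, Complex.norm_exp]
  simp

lemma integrableOn_cpow_cexp (s r : ℂ) (hs : 0 < s.re) (hr : 0 < r.re) :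
    IntegrableOn (fun t : ℝ => (t : ℂ) ^ (s - 1) * cexp (-(r * t))) (Set.Ioi 0) := by
  refine Integrable.mono' (integrableOn_rpow_exp s.re r.re hs hr) (aesm_cpow_exp s r) ?_
  refine (ae_restrict_iff' measurableSet_Ioi).2 (Filter.Eventually.of_forall fun t ht => ?_)
  exact (norm_cpow_exp s r t ht).le

lemma gamma_int_differentiableAt (s r₀ : ℂ) (hs : 0 < s.re) (hr : 0 < r₀.re) :
    DifferentiableAt ℂ (fun r : ℂ => ∫ t in Set.Ioi (0 : ℝ), (t : ℂ) ^ (s - 1) * cexp (-(r * t))) r₀ := by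
  have h := hasDerivAt_integral_of_dominated_loc_of_deriv_le
    (μ := volume.restrict (Set.Ioi (0 : ℝ)))
    (F := fun (r : ℂ) (t : ℝ) => (t : ℂ) ^ (s - 1) * cexp (-(r * t)))
    (F' := fun (r : ℂ) (t : ℝ) => (t : ℂ) ^ (s - 1) * (cexp (-(r * t)) * (-t)))
    (x₀ := r₀) (s := Metric.ball r₀ (r₀.re / 2))
    (bound := fun t => t ^ ((s.re + 1) - 1) * Real.exp (-(r₀.re / 2 * t)))
    (Metric.ball_mem_nhds _ (by linarith))
    (Filter.Eventually.of_forall fun r => aesm_cpow_exp s r)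
    (integrableOn_cpow_cexp s r₀ hs hr)
    (by
      have := (aesm_cpow_exp s r₀).mul (f := fun t : ℝ => (t : ℂ) ^ (s - 1) * cexp (-(r₀ * t)))
        (g := fun t : ℝ => (-t : ℂ)) (by fun_prop)
      refine this.congr (Filter.Eventually.of_forall fun t => ?_)
      simp [mul_assoc])
    (by
      refine (ae_restrict_iff' measurableSet_Ioi).2 (Filter.Eventually.of_forall fun t ht r hr' => ?_)
      have ht : 0 < t := ht
      rw [← mul_assoc, norm_mul, norm_cpow_exp s r t ht, norm_neg, norm_real,
        Real.norm_of_nonneg ht.le]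
      have h1 : r₀.re / 2 ≤ r.re := by
        have := Complex.abs_re_le_norm (r - r₀)
        rw [Metric.mem_ball, dist_eq_norm] at hr'
        have h3 := (abs_le.1 (this.trans hr'.le)).1
        simp only [sub_re] at h3
        linarith
      have e : t ^ ((s.re + 1) - 1) = t ^ (s.re - 1) * t := by
        rw [← Real.rpow_add_one ht.ne']; congr 1; ring
      rw [e, mul_right_comm]
      gcongr)
    (integrableOn_rpow_exp (s.re + 1) (r₀.re / 2) (by linarith) (by linarith))
    (by
      refine Filter.Eventually.of_forall fun t r _ => ?_
      refine HasDerivAt.const_mul _ ?_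
      have : HasDerivAt (fun r : ℂ => -(r * t)) (-(t : ℂ)) r := by
        simpa using ((hasDerivAt_id' r).mul_const (t : ℂ)).fun_neg
      exact this.cexp)
  exact h.2.differentiableAt

lemma gamma_int (s r : ℂ) (hs : 0 < s.re) (hr : 0 < r.re) :
    ∫ t in Set.Ioi (0 : ℝ), (t : ℂ) ^ (s - 1) * cexp (-(r * t)) = r ^ (-s) * Gamma s := by
  have hopen : IsOpen {r : ℂ | 0 < r.re} := isOpen_lt continuous_const continuous_re
  have h1 : AnalyticOnNhd ℂ (fun r : ℂ => ∫ t in Set.Ioi (0 : ℝ), (t : ℂ) ^ (s - 1) * cexp (-(r * t)))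
      {r : ℂ | 0 < r.re} :=
    DifferentiableOn.analyticOnNhd (fun r hr =>
      (gamma_int_differentiableAt s r hs hr).differentiableWithinAt) hopen
  have h2 : AnalyticOnNhd ℂ (fun r : ℂ => r ^ (-s) * Gamma s) {r : ℂ | 0 < r.re} := by
    refine DifferentiableOn.analyticOnNhd (fun r hr => ?_) hopen
    refine DifferentiableAt.differentiableWithinAt ?_
    refine DifferentiableAt.mul_const ?_ _
    exact differentiableAt_id.cpow_const (Or.inl hr)
  have hpre : IsPreconnected {r : ℂ | 0 < r.re} := (convex_halfSpace_re_gt 0).isPreconnected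
  have hreal : ∀ x : ℝ, 0 < x → (∫ t in Set.Ioi (0 : ℝ), (t : ℂ) ^ (s - 1) * cexp (-((x : ℂ) * t))) =
      (x : ℂ) ^ (-s) * Gamma s := by
    intro x hx
    rw [Complex.integral_cpow_mul_exp_neg_mul_Ioi hs hx, one_div, Complex.inv_cpow, Complex.cpow_neg]
    rw [Complex.arg_ofReal_of_nonneg hx.le]; exact Real.pi_pos.ne
  refine h1.eqOn_of_preconnected_of_frequently_eq h2 hpre (z₀ := 1) (by simp) ?_ hr
  have ht : Filter.Tendsto (fun x : ℝ => (x : ℂ)) (nhdsWithin 1 {1}ᶜ) (nhdsWithin 1 {1}ᶜ) := by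
    refine tendsto_nhdsWithin_iff.2 ⟨?_, ?_⟩
    · have : Filter.Tendsto (fun x : ℝ => (x : ℂ)) (nhds 1) (nhds 1) := by
        simpa using Complex.continuous_ofReal.tendsto 1
      exact this.mono_left nhdsWithin_le_nhds
    · filter_upwards [self_mem_nhdsWithin] with x hx
      simpa using hx
  refine ht.frequently ?_
  refine Filter.Eventually.frequently ?_
  filter_upwards [nhdsWithin_le_nhds (lt_mem_nhds (one_pos : (0 : ℝ) < 1))] with x hx
  exact hreal x hx

lemma cpow_real_mul (p : ℝ) (hp : 0 < p) (X : ℂ) (hX : X ≠ 0) (s : ℂ) :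
    ((p : ℂ) * X) ^ s = (p : ℂ) ^ s * X ^ s := by
  have hp' : (p : ℂ) ≠ 0 := ofReal_ne_zero.2 hp.ne'
  rw [cpow_def_of_ne_zero (mul_ne_zero hp' hX), cpow_def_of_ne_zero hp', cpow_def_of_ne_zero hX,
    Complex.log_ofReal_mul hp hX, ← Complex.exp_add, Complex.ofReal_log hp.le, add_mul]

end

section
open Complex MeasureTheory

noncomputable def gt (c : ℕ → ℂ) (b : ℝ) (w : ℂ) (n : ℕ) : ℂ :=
  c n * cexp (-(Real.pi * (n + b) ^ 2 * w))

noncomputable def gs (c : ℕ → ℂ) (b : ℝ) (w : ℂ) : ℂ := ∑' n, gt c b w n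

lemma gt_norm_le (c : ℕ → ℂ) (hc : ∀ n, ‖c n‖ ≤ 2) (b : ℝ) (hb : 0 < b) (w : ℂ) (hw : 0 < w.re) (n : ℕ) :
    ‖gt c b w n‖ ≤ 2 * Real.exp (-(Real.pi * b ^ 2 * w.re)) * Real.exp (-(Real.pi * w.re)) ^ n := by
  unfold gt
  rw [norm_mul, Complex.norm_exp, ← Real.exp_nat_mul, mul_assoc (2 : ℝ), ← Real.exp_add]
  refine mul_le_mul (hc n) ?_ (by positivity) (by norm_num)
  rw [Real.exp_le_exp]
  have e : (-((Real.pi : ℂ) * (n + b) ^ 2 * w)).re = -(Real.pi * (n + b) ^ 2 * w.re) := by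
    have : (Real.pi : ℂ) * (n + b) ^ 2 = ((Real.pi * (n + b) ^ 2 : ℝ) : ℂ) := by push_cast; ring
    rw [this, neg_re, re_ofReal_mul]
  rw [e]
  have h1 : (n : ℝ) + b ^ 2 ≤ (n + b) ^ 2 := by
    have h2 : (n : ℝ) ≤ (n : ℝ) ^ 2 := by exact_mod_cast Nat.le_self_pow (by norm_num) n
    nlinarith [(Nat.cast_nonneg n : (0 : ℝ) ≤ n)]
  have h3 : 0 < Real.pi * w.re := mul_pos Real.pi_pos hw
  nlinarith

lemma gt_ratio_lt (w : ℂ) (hw : 0 < w.re) : Real.exp (-(Real.pi * w.re)) < 1 := by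
  rw [Real.exp_lt_one_iff]
  have : 0 < Real.pi * w.re := mul_pos Real.pi_pos hw
  linarith

lemma gt_summable (c : ℕ → ℂ) (hc : ∀ n, ‖c n‖ ≤ 2) (b : ℝ) (hb : 0 < b) (w : ℂ) (hw : 0 < w.re) :
    Summable (gt c b w) :=
  Summable.of_norm_bounded ((summable_geometric_of_lt_one (by positivity) (gt_ratio_lt w hw)).mul_left _)
    (gt_norm_le c hc b hb w hw)

lemma gs_hasSum (c : ℕ → ℂ) (hc : ∀ n, ‖c n‖ ≤ 2) (b : ℝ) (hb : 0 < b) (w : ℂ) (hw : 0 < w.re) :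
    HasSum (gt c b w) (gs c b w) := (gt_summable c hc b hb w hw).hasSum

lemma gs_norm_le (c : ℕ → ℂ) (hc : ∀ n, ‖c n‖ ≤ 2) (b : ℝ) (hb : 0 < b) (w : ℂ) (hw : 0 < w.re) :
    ‖gs c b w‖ ≤ 2 * Real.exp (-(Real.pi * b ^ 2 * w.re)) * (1 - Real.exp (-(Real.pi * w.re)))⁻¹ :=
  tsum_of_norm_bounded ((hasSum_geometric_of_lt_one (by positivity) (gt_ratio_lt w hw)).mul_left _)
    (gt_norm_le c hc b hb w hw)

lemma gs_isBigO (c : ℕ → ℂ) (hc : ∀ n, ‖c n‖ ≤ 2) (b : ℝ) (hb : 0 < b) (X : ℂ) (hX : 0 < X.re) (r : ℝ) :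
    (fun t : ℝ => gs c b (X * t)) =O[Filter.atTop] (fun t : ℝ => t ^ r) := by
  have h0 : 0 < Real.pi * b ^ 2 * X.re := by have := Real.pi_pos; positivity
  have h1 : (fun t : ℝ => gs c b (X * t)) =O[Filter.atTop]
      (fun t : ℝ => Real.exp (-(Real.pi * b ^ 2 * X.re) * t)) := by
    refine Asymptotics.IsBigO.of_bound (2 * (1 - Real.exp (-(Real.pi * X.re)))⁻¹) ?_
    filter_upwards [Filter.eventually_ge_atTop 1] with t ht
    have hre : (X * t).re = X.re * t := by simp
    have ht0 : 0 < t := by linarith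
    have hw : 0 < (X * t).re := by rw [hre]; positivity
    refine (gs_norm_le c hc b hb _ hw).trans ?_
    rw [Real.norm_of_nonneg (Real.exp_pos _).le, hre]
    have e : -(Real.pi * b ^ 2 * (X.re * t)) = -(Real.pi * b ^ 2 * X.re) * t := by ring
    rw [e, mul_right_comm]
    have h3 : 0 < 1 - Real.exp (-(Real.pi * X.re)) := by have := gt_ratio_lt X hX; linarith
    have h4 : Real.exp (-(Real.pi * (X.re * t))) ≤ Real.exp (-(Real.pi * X.re)) := by
      rw [Real.exp_le_exp]
      have : X.re * 1 ≤ X.re * t := by gcongr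
      have := Real.pi_pos
      nlinarith
    gcongr
  exact h1.trans (isLittleO_exp_neg_mul_rpow_atTop h0 r).isBigO

lemma integrable_of_hasSum_aux {α : Type*} [MeasurableSpace α] {μ : Measure α} {F : ℕ → α → ℂ}
    {f : α → ℂ} (hF_int : ∀ i, Integrable (F i) μ) (hF_sum : Summable fun i ↦ ∫ a, ‖F i a‖ ∂μ)
    (hf : ∀ᵐ x ∂μ, HasSum (fun n => F n x) (f x)) : Integrable f μ := by
  refine ⟨aestronglyMeasurable_of_tendsto_ae Filter.atTop
    (f := fun N x => ∑ n ∈ Finset.range N, F n x) (fun N => ?_) ?_, ?_⟩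
  · exact (integrable_finsetSum _ fun n _ => hF_int n).aestronglyMeasurable
  · filter_upwards [hf] with x hx using hx.tendsto_sum_nat
  · have hle : ∫⁻ x, ‖f x‖ₑ ∂μ ≤ ∫⁻ x, ∑' n, ‖F n x‖ₑ ∂μ := by
      refine lintegral_mono_ae ?_
      filter_upwards [hf] with x hx
      have h2 : Filter.Tendsto (fun N => ‖∑ n ∈ Finset.range N, F n x‖ₑ) Filter.atTop (nhds ‖f x‖ₑ) :=
        hx.tendsto_sum_nat.enorm
      refine le_of_tendsto' h2 fun N => ?_
      exact (enorm_sum_le _ _).trans (ENNReal.sum_le_tsum _)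
    have he : ∫⁻ x, ∑' n, ‖F n x‖ₑ ∂μ = ∑' n, ∫⁻ x, ‖F n x‖ₑ ∂μ :=
      lintegral_tsum fun n => (hF_int n).aestronglyMeasurable.enorm
    have hn : ∀ n, ∫⁻ x, ‖F n x‖ₑ ∂μ = ENNReal.ofReal (∫ a, ‖F n a‖ ∂μ) := fun n =>
      (ofReal_integral_norm_eq_lintegral_enorm (hF_int n)).symm
    refine lt_of_le_of_lt (hle.trans he.le) ?_
    simp_rw [hn]
    rw [← ENNReal.ofReal_tsum_of_nonneg (fun n => integral_nonneg fun a => norm_nonneg _) hF_sum]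
    exact ENNReal.ofReal_lt_top

/-- Mellin transform of a family. -/
lemma gs_mellin (c : ℕ → ℂ) (hc : ∀ n, ‖c n‖ ≤ 2) (b : ℝ) (hb : 0 < b) (X : ℂ) (hX : 0 < X.re)
    (s : ℂ) (hs : 1 / 2 < s.re) (D : ℂ) (hD : HasSum (fun n : ℕ => c n / ((n : ℂ) + b) ^ (2 * s)) D) :
    HasMellin (fun t : ℝ => gs c b (X * t)) s ((Real.pi : ℂ) ^ (-s) * Gamma s * X ^ (-s) * D) := by
  have hs0 : 0 < s.re := by linarith
  have hX0 : X ≠ 0 := by rintro rfl; simp at hX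
  set q : ℕ → ℝ := fun n => Real.pi * (n + b) ^ 2 with hq
  have hq0 : ∀ n, 0 < q n := fun n => by simp only [hq]; positivity
  have hF : ∀ n : ℕ, ∀ t : ℝ, (t : ℂ) ^ (s - 1) * gt c b (X * t) n =
      c n * ((t : ℂ) ^ (s - 1) * cexp (-((q n * X) * t))) := by
    intro n t
    unfold gt
    simp only [hq]
    push_cast
    ring_nf
  have hqre : ∀ n, ((q n : ℂ) * X).re = q n * X.re := fun n => by simp
  have hqp : ∀ n, 0 < ((q n : ℂ) * X).re := fun n => by rw [hqre]; exact mul_pos (hq0 n) hX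
  have hInt : ∀ n, IntegrableOn (fun t : ℝ => (t : ℂ) ^ (s - 1) * gt c b (X * t) n) (Set.Ioi 0) := by
    intro n
    simp_rw [hF]
    exact (integrableOn_cpow_cexp s _ hs0 (hqp n)).const_mul _
  have hval : ∀ n, ∫ t in Set.Ioi (0 : ℝ), (t : ℂ) ^ (s - 1) * gt c b (X * t) n =
      (Real.pi : ℂ) ^ (-s) * Gamma s * X ^ (-s) * (c n / ((n : ℂ) + b) ^ (2 * s)) := by
    intro n
    simp_rw [hF]
    rw [integral_const_mul, gamma_int s _ hs0 (hqp n), cpow_real_mul _ (hq0 n) _ hX0]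
    have hnb : (0 : ℝ) < n + b := by positivity
    have e1 : ((q n : ℝ) : ℂ) ^ (-s) = (Real.pi : ℂ) ^ (-s) * (((n : ℂ) + b) ^ (2 * s))⁻¹ := by
      simp only [hq]
      rw [ofReal_mul, mul_cpow_ofReal_nonneg Real.pi_pos.le (by positivity), ← cpow_neg]
      congr 1
      have : ((((n : ℝ) + b) ^ 2 : ℝ) : ℂ) = ((((n : ℝ) + b) : ℝ) : ℂ) * ((((n : ℝ) + b) : ℝ) : ℂ) := by
        push_cast; ring
      rw [this, mul_cpow_ofReal_nonneg hnb.le hnb.le, ← cpow_add _ _ (ofReal_ne_zero.2 hnb.ne')]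
      push_cast
      congr 1
      ring
    rw [e1]
    ring
  have hnint : ∀ n, ∫ t in Set.Ioi (0 : ℝ), ‖(t : ℂ) ^ (s - 1) * gt c b (X * t) n‖ =
      ‖c n‖ * ((1 / (q n * X.re)) ^ s.re * Real.Gamma s.re) := by
    intro n
    rw [← Real.integral_rpow_mul_exp_neg_mul_Ioi hs0 (mul_pos (hq0 n) hX), ← integral_const_mul]
    refine setIntegral_congr_fun measurableSet_Ioi fun t ht => ?_
    simp only [hF]
    rw [norm_mul, norm_cpow_exp _ _ _ ht, hqre]
  have hsummable : Summable fun n => ∫ t in Set.Ioi (0 : ℝ), ‖(t : ℂ) ^ (s - 1) * gt c b (X * t) n‖ := by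
    simp_rw [hnint]
    have hbs : Summable fun n : ℕ => 1 / |(n : ℝ) + b| ^ (2 * s.re) :=
      Real.summable_one_div_nat_add_rpow b (2 * s.re) |>.2 (by linarith)
    refine Summable.of_nonneg_of_le (fun n => ?_) (fun n => ?_)
      (hbs.mul_left (2 * ((1 / (Real.pi * X.re)) ^ s.re * Real.Gamma s.re)))
    · have := Real.Gamma_pos_of_pos hs0
      have := mul_pos (hq0 n) hX
      positivity
    · have hnb : (0 : ℝ) < n + b := by positivity
      have hpx : 0 < Real.pi * X.re := mul_pos Real.pi_pos hX
      have hg := Real.Gamma_pos_of_pos hs0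
      have e2 : (1 / (q n * X.re)) ^ s.re = (1 / (Real.pi * X.re)) ^ s.re * (1 / |(n : ℝ) + b| ^ (2 * s.re)) := by
        rw [abs_of_pos hnb, Real.rpow_mul hnb.le]
        have : (1 : ℝ) / (q n * X.re) = (1 / (Real.pi * X.re)) * (1 / ((n : ℝ) + b) ^ (2 : ℝ)) := by
          simp only [hq]
          rw [Real.rpow_two]
          field_simp
        rw [this, Real.mul_rpow (by positivity) (by positivity),
          Real.div_rpow zero_le_one (by positivity) (s.re) (x := 1) (y := ((n : ℝ) + b) ^ (2 : ℝ)), Real.one_rpow]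
      rw [e2]
      have : 0 ≤ ((1 / (Real.pi * X.re)) ^ s.re * (1 / |(n : ℝ) + b| ^ (2 * s.re)) * Real.Gamma s.re) := by
        positivity
      calc _ ≤ 2 * ((1 / (Real.pi * X.re)) ^ s.re * (1 / |(n : ℝ) + b| ^ (2 * s.re)) * Real.Gamma s.re) :=
            mul_le_mul_of_nonneg_right (hc n) this
        _ = _ := by ring
  have hpt : ∀ t ∈ Set.Ioi (0 : ℝ), HasSum (fun n => (t : ℂ) ^ (s - 1) * gt c b (X * t) n)
      ((t : ℂ) ^ (s - 1) * gs c b (X * t)) := by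
    intro t ht
    refine HasSum.mul_left _ (gs_hasSum c hc b hb _ ?_)
    have : (X * t).re = X.re * t := by simp
    rw [this]; exact mul_pos hX ht
  have hmain := hasSum_integral_of_summable_integral_norm (μ := volume.restrict (Set.Ioi (0 : ℝ)))
    hInt hsummable
  have e3 : ∫ t in Set.Ioi (0 : ℝ), ∑' n, (t : ℂ) ^ (s - 1) * gt c b (X * t) n =
      mellin (fun t : ℝ => gs c b (X * t)) s := by
    unfold mellin
    refine setIntegral_congr_fun measurableSet_Ioi fun t ht => ?_
    simp only [smul_eq_mul]
    exact (hpt t ht).tsum_eq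
  have hconv : MellinConvergent (fun t : ℝ => gs c b (X * t)) s := by
    exact integrable_of_hasSum_aux hInt hsummable
      ((ae_restrict_iff' measurableSet_Ioi).2 (Filter.Eventually.of_forall hpt))
  refine ⟨hconv, ?_⟩
  rw [← e3]
  simp_rw [hval] at hmain
  exact hmain.unique (hD.mul_left _)

end

section
open Complex MeasureTheory

noncomputable def Th1 (a : ℝ) (w : ℂ) : ℂ :=
  cexp (-(Real.pi * a ^ 2 * w)) * jacobiTheta₂ (a * I * w) (I * w)
noncomputable def Th2 (a : ℝ) (w : ℂ) : ℂ := jacobiTheta₂ a (I * w)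
noncomputable def Th (a : ℝ) (w : ℂ) : ℂ := Th1 a w + Th2 a w

noncomputable def c1 (_ : ℕ) : ℂ := 1
noncomputable def c3 (a : ℝ) (n : ℕ) : ℂ := cexp (2 * Real.pi * I * a * (n + 1))

lemma c1_le (n : ℕ) : ‖c1 n‖ ≤ 2 := by simp [c1]
lemma c3_le (a : ℝ) (n : ℕ) : ‖c3 a n‖ ≤ 2 := by
  unfold c3
  have : (2 * Real.pi * I * a * (n + 1) : ℂ) = ((2 * Real.pi * a * (n + 1) : ℝ) : ℂ) * I := by
    push_cast; ring
  rw [this, norm_exp_ofReal_mul_I]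
  norm_num

lemma Th_eq (a : ℝ) (ha : 0 < a) (ha1 : a < 1) (w : ℂ) (hw : 0 < w.re) :
    Th a w = 1 + (gs c1 a w + gs c1 (1 - a) w + gs (c3 a) 1 w + gs (c3 (1 - a)) 1 w) := by
  have him : 0 < (I * w).im := by simpa using hw
  have h1 := (hasSum_jacobiTheta₂_term (a * I * w) him).mul_left (cexp (-(Real.pi * a ^ 2 * w)))
  have h1' := HasSum.of_nat_of_neg_add_one
    (f := fun n : ℤ => cexp (-(Real.pi * a ^ 2 * w)) * jacobiTheta₂_term n (a * I * w) (I * w))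
    ((gs_hasSum c1 c1_le a ha w hw).congr_fun (fun n => by
      unfold gt jacobiTheta₂_term c1
      rw [one_mul, ← Complex.exp_add]
      congr 1
      push_cast
      linear_combination (2 * Real.pi * n * a * w + Real.pi * n ^ 2 * w) * I_sq))
    ((gs_hasSum c1 c1_le (1 - a) (by linarith) w hw).congr_fun (fun n => by
      unfold gt jacobiTheta₂_term c1
      rw [one_mul, ← Complex.exp_add]
      congr 1
      push_cast
      linear_combination (-(2 * Real.pi * (n + 1) * a * w) + Real.pi * (n + 1) ^ 2 * w) * I_sq))
  have e1 := h1.unique h1'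
  have h2 := hasSum_jacobiTheta₂_term (a : ℂ) him
  have h2' := HasSum.of_add_one_of_neg_add_one
    (f := fun n : ℤ => jacobiTheta₂_term n a (I * w))
    ((gs_hasSum (c3 a) (c3_le a) 1 one_pos w hw).congr_fun (fun n => by
      unfold gt jacobiTheta₂_term c3
      rw [← Complex.exp_add]
      congr 1
      push_cast
      linear_combination (Real.pi * (n + 1) ^ 2 * w) * I_sq))
    ((gs_hasSum (c3 (1 - a)) (c3_le _) 1 one_pos w hw).congr_fun (fun n => by
      unfold gt jacobiTheta₂_term c3
      rw [← Complex.exp_add, Complex.exp_eq_exp_iff_exists_int]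
      refine ⟨-(n + 1), ?_⟩
      push_cast
      linear_combination (Real.pi * (n + 1) ^ 2 * w) * I_sq))
  have e2 := h2.unique h2'
  unfold Th Th1 Th2
  rw [e1, e2]
  have : jacobiTheta₂_term 0 (a : ℂ) (I * w) = 1 := by simp [jacobiTheta₂_term]
  rw [this]
  ring

lemma re_inv_pos (w : ℂ) (hw : 0 < w.re) : 0 < (1 / w).re := by
  have hw0 : w ≠ 0 := by rintro rfl; simp at hw
  rw [one_div, inv_re]
  exact div_pos hw (normSq_pos.2 hw0)

lemma arg_ne_pi (w : ℂ) (hw : 0 < w.re) : w.arg ≠ Real.pi := by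
  intro h
  have := (Complex.arg_eq_pi_iff.1 h).1
  linarith

lemma Th2_eq (a : ℝ) (w : ℂ) (hw : 0 < w.re) :
    Th2 a w = (w ^ (1 / 2 : ℂ))⁻¹ * Th1 a (1 / w) := by
  have hw0 : w ≠ 0 := by rintro rfl; simp at hw
  unfold Th2 Th1
  rw [jacobiTheta₂_functional_equation]
  have e0 : -I * (I * w) = w := by linear_combination (-w) * I_sq
  have e1 : (a : ℂ) / (I * w) = -(a * I * (1 / w)) := by
    field_simp
    rw [I_sq]
    ring
  have e2 : -1 / (I * w) = I * (1 / w) := by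
    field_simp
    rw [I_sq]
  have e3 : -(Real.pi : ℂ) * I * a ^ 2 / (I * w) = -(Real.pi * a ^ 2 * (1 / w)) := by
    have := I_ne_zero
    field_simp
  rw [e0, e1, e2, e3, jacobiTheta₂_neg_left]
  ring

lemma Th_feq (a : ℝ) (w : ℂ) (hw : 0 < w.re) : Th a (1 / w) = w ^ (1 / 2 : ℂ) * Th a w := by
  have hw0 : w ≠ 0 := by rintro rfl; simp at hw
  have h1 := Th2_eq a w hw
  have h2 := Th2_eq a (1 / w) (re_inv_pos w hw)
  rw [one_div_one_div, one_div, inv_cpow _ _ (arg_ne_pi w hw), inv_inv] at h2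
  unfold Th
  rw [one_div, h2, h1, one_div]
  have : w ^ (1 / 2 : ℂ) ≠ 0 := by simp [cpow_eq_zero_iff, hw0]
  field_simp
  ring

lemma Th_conj (a : ℝ) (w : ℂ) : (starRingEnd ℂ) (Th a w) = Th a ((starRingEnd ℂ) w) := by
  unfold Th Th1 Th2
  rw [map_add, map_mul, ← Complex.exp_conj, jacobiTheta₂_conj, jacobiTheta₂_conj]
  simp only [map_neg, map_mul, map_pow, conj_ofReal, conj_I]
  have e1 : (a : ℂ) * -I * (starRingEnd ℂ) w = -(a * I * (starRingEnd ℂ) w) := by ring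
  have e2 : -(-I * (starRingEnd ℂ) w) = I * (starRingEnd ℂ) w := by ring
  rw [e1, e2, jacobiTheta₂_neg_left]

lemma Th_continuousAt (a : ℝ) (w : ℂ) (hw : 0 < w.re) : ContinuousAt (Th a) w := by
  have him : 0 < (I * w).im := by simpa using hw
  unfold Th Th1 Th2
  refine ContinuousAt.add (ContinuousAt.mul (by fun_prop) ?_) ?_
  · exact ContinuousAt.comp (f := fun w : ℂ => ((a * I * w, I * w) : ℂ × ℂ))
      (g := fun p : ℂ × ℂ ↦ jacobiTheta₂ p.1 p.2) (continuousAt_jacobiTheta₂ _ him) (by fun_prop)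
  · exact ContinuousAt.comp (f := fun w : ℂ => (((a : ℂ), I * w) : ℂ × ℂ))
      (g := fun p : ℂ × ℂ ↦ jacobiTheta₂ p.1 p.2) (continuousAt_jacobiTheta₂ _ him) (by fun_prop)

lemma Th_isBigO (a : ℝ) (ha : 0 < a) (ha1 : a < 1) (X : ℂ) (hX : 0 < X.re) (r : ℝ) :
    (fun t : ℝ => Th a (X * t) - 1) =O[Filter.atTop] (fun t : ℝ => t ^ r) := by
  have h := (((gs_isBigO c1 c1_le a ha X hX r).add (gs_isBigO c1 c1_le (1 - a) (by linarith) X hX r)).add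
    (gs_isBigO (c3 a) (c3_le a) 1 one_pos X hX r)).add
    (gs_isBigO (c3 (1 - a)) (c3_le (1 - a)) 1 one_pos X hX r)
  refine h.congr' ?_ Filter.EventuallyEq.rfl
  filter_upwards [Filter.eventually_gt_atTop 0] with t ht
  rw [Th_eq a ha ha1 _ (by simpa using mul_pos hX ht)]
  ring

lemma conj_re_pos (X : ℂ) (hX : 0 < X.re) : 0 < ((starRingEnd ℂ) X).re := by simpa using hX

lemma Th_locInt (a : ℝ) (X : ℂ) (hX : 0 < X.re) :
    LocallyIntegrableOn (fun t : ℝ => Th a (X * t)) (Set.Ioi 0) := by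
  refine ContinuousOn.locallyIntegrableOn (fun t ht => ?_) measurableSet_Ioi
  refine ContinuousAt.continuousWithinAt ?_
  exact ContinuousAt.comp (f := fun t : ℝ => X * t) (g := Th a)
    (Th_continuousAt a _ (by simpa using mul_pos hX ht)) (by fun_prop)

noncomputable def PP (a : ℝ) (ha : 0 < a) (ha1 : a < 1) (X : ℂ) (hX : 0 < X.re) (hn : ‖X‖ = 1) :
    WeakFEPair ℂ where
  f := fun t => Th a (X * t)
  g := fun t => Th a ((starRingEnd ℂ) X * t)
  k := 1 / 2
  ε := ((starRingEnd ℂ) X) ^ (1 / 2 : ℂ)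
  f₀ := 1
  g₀ := 1
  hf_int := Th_locInt a X hX
  hg_int := Th_locInt a _ (conj_re_pos X hX)
  hk := by norm_num
  hε := by
    have : X ≠ 0 := by rintro rfl; simp at hX
    simp [cpow_eq_zero_iff, this]
  h_feq := by
    intro t ht
    have ht : 0 < t := ht
    have hX0 : X ≠ 0 := by rintro rfl; simp at hX
    have hXc : (starRingEnd ℂ) X ≠ 0 := by simpa using hX0
    have hc : (starRingEnd ℂ) X * X = 1 := by
      rw [mul_comm, Complex.mul_conj']
      simp [hn]
    have e : X * ((1 / t : ℝ) : ℂ) = 1 / (t * (starRingEnd ℂ) X) := by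
      have ht' : (t : ℂ) ≠ 0 := ofReal_ne_zero.2 ht.ne'
      push_cast
      field_simp
      linear_combination hc
    have hre : 0 < ((t : ℂ) * (starRingEnd ℂ) X).re := by simpa using mul_pos ht hX
    rw [e, Th_feq a _ hre, cpow_real_mul t ht _ hXc, mul_comm (t : ℂ) ((starRingEnd ℂ) X), smul_eq_mul,
      ofReal_cpow ht.le]
    push_cast
    ring
  hf_top := Th_isBigO a ha ha1 X hX
  hg_top := Th_isBigO a ha ha1 _ (conj_re_pos X hX)

end

section
open Complex MeasureTheory

lemma hz_sum (b : ℝ) (hb : 0 < b) (hb1 : b < 1) (s : ℂ) (hs : 1 / 2 < s.re) :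
    HasSum (fun n : ℕ => c1 n / ((n : ℂ) + b) ^ (2 * s)) (hzeta b (2 * s)) :=
  HurwitzZeta.hasSum_hurwitzZeta_of_one_lt_re ⟨hb.le, hb1.le⟩ (by simp; linarith)

lemma pz_sum (b : ℝ) (s : ℂ) (hs : 1 / 2 < s.re) :
    HasSum (fun n : ℕ => c3 b n / ((n : ℂ) + (1 : ℝ)) ^ (2 * s)) (pzeta b (2 * s)) := by
  have h := HurwitzZeta.hasSum_expZeta_of_one_lt_re b (s := 2 * s) (by simp; linarith)
  have h2 := (hasSum_nat_add_iff' 1).2 h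
  have hs0 : s ≠ 0 := by rintro rfl; simp at hs; linarith
  simp only [Finset.range_one, Finset.sum_singleton, Nat.cast_zero] at h2
  rw [zero_cpow (mul_ne_zero two_ne_zero hs0), div_zero, sub_zero] at h2
  unfold pzeta c3
  simpa using h2

lemma PP_Lambda_right (a : ℝ) (ha : 0 < a) (ha1 : a < 1) (X : ℂ) (hX : 0 < X.re) (hn : ‖X‖ = 1)
    (s : ℂ) (hs : 1 / 2 < s.re) :
    (PP a ha ha1 X hX hn).Λ s =
      (Real.pi : ℂ) ^ (-s) * Gamma s * X ^ (-s) * (2 * Qzeta (2 * s) a) := by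
  have h := (PP a ha ha1 X hX hn).hasMellin (s := s) hs
  have m1 := gs_mellin c1 c1_le a ha X hX s hs _ (hz_sum a ha ha1 s hs)
  have m2 := gs_mellin c1 c1_le (1 - a) (by linarith) X hX s hs _
    (hz_sum (1 - a) (by linarith) (by linarith) s hs)
  have m3 := gs_mellin (c3 a) (c3_le a) 1 one_pos X hX s hs _ (pz_sum a s hs)
  have m4 := gs_mellin (c3 (1 - a)) (c3_le (1 - a)) 1 one_pos X hX s hs _ (pz_sum (1 - a) s hs)
  have m12 := hasMellin_add m1.1 m2.1
  have m123 := hasMellin_add m12.1 m3.1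
  have m := hasMellin_add m123.1 m4.1
  rw [← h.2]
  have e : mellin (fun t => (PP a ha ha1 X hX hn).f t - (PP a ha ha1 X hX hn).f₀) s =
      mellin (fun t : ℝ => gs c1 a (X * t) + gs c1 (1 - a) (X * t) + gs (c3 a) 1 (X * t) +
        gs (c3 (1 - a)) 1 (X * t)) s := by
    refine setIntegral_congr_fun measurableSet_Ioi fun t ht => ?_
    have ht : 0 < t := ht
    simp only [PP]
    rw [Th_eq a ha ha1 _ (by simpa using mul_pos hX ht)]
    congr 1
    ring
  rw [e, m.2, m123.2, m12.2, m1.2, m2.2, m3.2, m4.2]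
  unfold Qzeta
  ring

lemma ne_zero_circle (a : ℝ) (ha : 0 < a) (ha1 : a < 1) : (a : UnitAddCircle) ≠ 0 := by
  intro h
  rw [AddCircle.coe_eq_zero_iff] at h
  obtain ⟨n, hn⟩ := h
  simp at hn
  rw [← hn] at ha ha1
  have h1 : 0 < n := by exact_mod_cast ha
  have h2 : n < 1 := by exact_mod_cast ha1
  omega

lemma Q_diff (a : ℝ) (ha : 0 < a) (ha1 : a < 1) (s : ℂ) (hs : s ≠ 1) :
    DifferentiableAt ℂ (fun s => Qzeta s a) s := by
  unfold Qzeta hzeta pzeta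
  refine DifferentiableAt.div_const ?_ _
  refine ((DifferentiableAt.add ?_ ?_).add ?_).add ?_
  · exact HurwitzZeta.differentiableAt_hurwitzZeta _ hs
  · exact HurwitzZeta.differentiableAt_hurwitzZeta _ hs
  · exact HurwitzZeta.differentiableAt_expZeta _ _ (Or.inl hs)
  · exact HurwitzZeta.differentiableAt_expZeta _ _ (Or.inl hs)

lemma PP_Lambda (a : ℝ) (ha : 0 < a) (ha1 : a < 1) (X : ℂ) (hX : 0 < X.re) (hn : ‖X‖ = 1)
    (s : ℂ) (hs : 0 < s.re) (hs' : s ≠ 1 / 2) :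
    (PP a ha ha1 X hX hn).Λ s =
      (Real.pi : ℂ) ^ (-s) * Gamma s * X ^ (-s) * (2 * Qzeta (2 * s) a) := by
  have hX0 : X ≠ 0 := by rintro rfl; simp at hX
  have hpi : (Real.pi : ℂ) ≠ 0 := ofReal_ne_zero.2 Real.pi_ne_zero
  set U : Set ℂ := ({0, 1 / 2} : Set ℂ)ᶜ with hU
  have hUo : IsOpen U := (Set.Finite.isClosed (by simp)).isOpen_compl
  have hpre : IsPreconnected U :=
    (Set.Countable.isConnected_compl_of_one_lt_rank (by simp) (Set.toFinite _).countable).isPreconnected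
  have h1 : AnalyticOnNhd ℂ (fun s => (PP a ha ha1 X hX hn).Λ s * (Gamma s)⁻¹) U := by
    refine DifferentiableOn.analyticOnNhd (fun s hs => ?_) hUo
    simp only [hU, Set.mem_compl_iff, Set.mem_insert_iff, Set.mem_singleton_iff, not_or] at hs
    refine DifferentiableAt.differentiableWithinAt (DifferentiableAt.mul ?_ ?_)
    · refine (PP a ha ha1 X hX hn).differentiableAt_Λ (Or.inl hs.1) (Or.inl ?_)
      simpa [PP] using hs.2
    · exact differentiable_one_div_Gamma s
  have h2 : AnalyticOnNhd ℂ (fun s => (Real.pi : ℂ) ^ (-s) * X ^ (-s) * (2 * Qzeta (2 * s) a)) U := by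
    refine DifferentiableOn.analyticOnNhd (fun s hs => ?_) hUo
    simp only [hU, Set.mem_compl_iff, Set.mem_insert_iff, Set.mem_singleton_iff, not_or] at hs
    refine DifferentiableAt.differentiableWithinAt ?_
    have hs2 : 2 * s ≠ 1 := by
      intro h
      exact hs.2 (by linear_combination h / 2)
    refine DifferentiableAt.mul (DifferentiableAt.mul ?_ ?_) (DifferentiableAt.const_mul ?_ _)
    · exact DifferentiableAt.const_cpow (by fun_prop) (Or.inl hpi)
    · exact DifferentiableAt.const_cpow (by fun_prop) (Or.inl hX0)
    · exact DifferentiableAt.comp (f := fun s : ℂ => 2 * s) (g := fun s => Qzeta s a) s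
        (Q_diff a ha ha1 _ hs2) (by fun_prop)
  have hev : (fun s => (PP a ha ha1 X hX hn).Λ s * (Gamma s)⁻¹) =ᶠ[nhds (1 : ℂ)]
      (fun s => (Real.pi : ℂ) ^ (-s) * X ^ (-s) * (2 * Qzeta (2 * s) a)) := by
    have : {s : ℂ | 1 / 2 < s.re} ∈ nhds (1 : ℂ) :=
      (isOpen_lt continuous_const continuous_re).mem_nhds (by norm_num)
    filter_upwards [this] with s hs
    have hs : 1 / 2 < s.re := hs
    have hG : Gamma s ≠ 0 := Gamma_ne_zero_of_re_pos (by linarith)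
    rw [PP_Lambda_right a ha ha1 X hX hn s hs]
    field_simp
  have := h1.eqOn_of_preconnected_of_eventuallyEq h2 hpre (z₀ := 1) (by simp [hU]) hev
    (x := s) (by
      simp only [hU, Set.mem_compl_iff, Set.mem_insert_iff, Set.mem_singleton_iff, not_or]
      exact ⟨by rintro rfl; simp at hs, hs'⟩)
  have hG : Gamma s ≠ 0 := Gamma_ne_zero_of_re_pos hs
  simp only at this
  rw [mul_inv_eq_iff_eq_mul₀ hG] at this
  rw [this]
  ring

noncomputable def HH (a : ℝ) (X : ℂ) (t : ℝ) : ℂ :=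
  Th a (X * t) - 1 - ((starRingEnd ℂ) X) ^ (1 / 2 : ℂ) * (t : ℂ) ^ (-(1 / 2) : ℂ)

lemma HH_mellin (a : ℝ) (ha : 0 < a) (ha1 : a < 1) (X : ℂ) (hX : 0 < X.re) (hn : ‖X‖ = 1)
    (s : ℂ) (hs : 0 < s.re) (hs' : s.re < 1 / 2) :
    HasMellin (HH a X) s
      ((Real.pi : ℂ) ^ (-s) * Gamma s * X ^ (-s) * (2 * Qzeta (2 * s) a)) := by
  have hs2 : s ≠ 1 / 2 := by rintro rfl; norm_num at hs'
  rw [← PP_Lambda a ha ha1 X hX hn s hs hs2]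
  set P := PP a ha ha1 X hX hn with hP
  set ε : ℂ := ((starRingEnd ℂ) X) ^ (1 / 2 : ℂ) with hε
  have m0 := P.isStrongFEPair_toStrongFEPair.hasMellin s
  have m1 : HasMellin ((Set.Ioc 0 1).indicator fun _ => (1 : ℂ)) s (1 / s) := hasMellin_one_Ioc hs
  have hre : (s - 1 / 2 - 1).re < -1 := by
    simp; linarith
  have m2 : HasMellin ((Set.Ioi (1 : ℝ)).indicator fun t : ℝ => ε * (t : ℂ) ^ (-(1 / 2) : ℂ)) s
      (ε / (1 / 2 - s)) := by
    have hfun : ∀ t ∈ Set.Ioi (0 : ℝ), (t : ℂ) ^ (s - 1) •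
        ((Set.Ioi (1 : ℝ)).indicator (fun t : ℝ => ε * (t : ℂ) ^ (-(1 / 2) : ℂ))) t =
        (Set.Ioi (1 : ℝ)).indicator (fun t : ℝ => ε * (t : ℂ) ^ (s - 1 / 2 - 1)) t := by
      intro t ht
      have ht : 0 < t := ht
      by_cases h1 : t ∈ Set.Ioi (1 : ℝ)
      · rw [Set.indicator_of_mem h1, Set.indicator_of_mem h1, smul_eq_mul]
        have : (t : ℂ) ^ (s - 1 / 2 - 1) = (t : ℂ) ^ (s - 1) * (t : ℂ) ^ (-(1 / 2) : ℂ) := by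
          rw [← cpow_add _ _ (ofReal_ne_zero.2 ht.ne')]
          congr 1; ring
        rw [this]; ring
      · rw [Set.indicator_of_notMem h1, Set.indicator_of_notMem h1, smul_zero]
    have hI : IntegrableOn (fun t : ℝ => ε * (t : ℂ) ^ (s - 1 / 2 - 1)) (Set.Ioi 1) :=
      (integrableOn_Ioi_cpow_of_lt hre one_pos).const_mul ε
    constructor
    · unfold MellinConvergent
      refine IntegrableOn.congr_fun ?_ (fun t ht => (hfun t ht).symm) measurableSet_Ioi
      exact (hI.integrable_indicator measurableSet_Ioi).integrableOn
    · unfold mellin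
      rw [setIntegral_congr_fun measurableSet_Ioi hfun, setIntegral_indicator measurableSet_Ioi]
      have : Set.Ioi (0 : ℝ) ∩ Set.Ioi 1 = Set.Ioi 1 := by
        rw [Set.Ioi_inter_Ioi]; norm_num
      rw [this, integral_const_mul, integral_Ioi_cpow_of_lt hre one_pos]
      have hh : (1 / 2 : ℂ) - s ≠ 0 := sub_ne_zero.2 hs2.symm
      have hh' : s - 1 / 2 ≠ (0 : ℂ) := sub_ne_zero.2 hs2
      simp only [ofReal_one, one_cpow, sub_add_cancel]
      rw [mul_div_assoc', div_eq_div_iff hh' hh]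
      ring
  have m01 := hasMellin_sub m0.1 m1.1
  have m := hasMellin_sub m01.1 m2.1
  have hae : ∀ᵐ (t : ℝ) ∂(volume.restrict (Set.Ioi (0 : ℝ))), (t : ℂ) ^ (s - 1) •
      (P.toStrongFEPair.f t - ((Set.Ioc 0 1).indicator fun _ => (1 : ℂ)) t -
        ((Set.Ioi (1 : ℝ)).indicator fun t : ℝ => ε * (t : ℂ) ^ (-(1 / 2) : ℂ)) t) =
      (t : ℂ) ^ (s - 1) • HH a X t := by
    refine (ae_restrict_iff' measurableSet_Ioi).2 ?_
    filter_upwards [compl_mem_ae_iff.mpr (Set.Subsingleton.measure_zero (s := {1}) (by simp) _)]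
      with t (ht₁ : t ≠ 1) (ht₀ : 0 < t)
    congr 1
    unfold HH
    simp only [WeakFEPair.toStrongFEPair, WeakFEPair.f_modif, hP, PP, Pi.add_apply]
    rcases lt_or_gt_of_ne ht₁ with h | h
    · rw [Set.indicator_of_notMem (by simp; exact h.le), Set.indicator_of_mem (by exact ⟨ht₀, h⟩),
        Set.indicator_of_mem (by exact ⟨ht₀, h.le⟩), Set.indicator_of_notMem (by simp; exact h.le),
        ofReal_cpow ht₀.le]
      push_cast
      simp only [smul_eq_mul]
      ring
    · rw [Set.indicator_of_mem (by exact h), Set.indicator_of_notMem (by simp; intro _; exact h.le),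
        Set.indicator_of_notMem (by simp; intro _; exact h),
        Set.indicator_of_mem (by exact h)]
      ring
  constructor
  · exact (Integrable.congr m.1 hae)
  · have e : mellin (HH a X) s = mellin (fun t => P.toStrongFEPair.f t -
        ((Set.Ioc 0 1).indicator fun _ => (1 : ℂ)) t -
        ((Set.Ioi (1 : ℝ)).indicator fun t : ℝ => ε * (t : ℂ) ^ (-(1 / 2) : ℂ)) t) s :=
      (integral_congr_ae hae).symm
    rw [e, m.2, m01.2, m1.2, m2.2]
    simp only [WeakFEPair.Λ, WeakFEPair.Λ₀]
    have h1 : P.f₀ = 1 := rfl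
    have h2 : P.g₀ = 1 := rfl
    have h3 : P.ε = ε := rfl
    have h4 : ((P.k : ℝ) : ℂ) = 1 / 2 := by
      simp only [hP, PP]; push_cast; rfl
    rw [h1, h2, h3, h4, smul_eq_mul, smul_eq_mul, mul_one, mul_one]
    rfl

end

section
open Complex MeasureTheory
open FourierTransform

noncomputable def hh (a : ℝ) (X : ℂ) (u : ℝ) : ℂ :=
  Real.exp (-(1 / 4) * u) • HH a X (Real.exp (-u))

lemma hh_integrable (a : ℝ) (ha : 0 < a) (ha1 : a < 1) (X : ℂ) (hX : 0 < X.re) (hn : ‖X‖ = 1) :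
    Integrable (hh a X) := by
  have h := (HH_mellin a ha ha1 X hX hn (1 / 4) (by norm_num) (by norm_num)).1
  unfold MellinConvergent at h
  have him : (fun u : ℝ => Real.exp (-u)) '' Set.univ = Set.Ioi 0 := by
    rw [Set.image_univ, Set.range_comp' Real.exp (fun u : ℝ => -u), neg_surjective.range_eq, Set.image_univ, Real.range_exp]
  rw [← him, integrableOn_image_iff_integrableOn_abs_deriv_smul MeasurableSet.univ
    (f := fun u : ℝ => Real.exp (-u)) (f' := fun u => -Real.exp (-u))
    (fun u _ => (by simpa using (hasDerivAt_neg u).exp))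
    (Real.exp_injective.injOn.comp neg_injective.injOn (Set.mapsTo_univ _ _)),
    integrableOn_univ] at h
  refine h.congr (Filter.Eventually.of_forall fun u => ?_)
  unfold hh
  simp only [abs_neg, Real.abs_exp, smul_eq_mul, real_smul]
  rw [← mul_assoc]
  congr 1
  rw [ofReal_exp, cpow_def_of_ne_zero (Complex.exp_ne_zero _), ← ofReal_exp, ← ofReal_log (Real.exp_pos _).le, Real.log_exp, ofReal_exp, ofReal_exp,
    ← Complex.exp_add]
  congr 1
  push_cast
  ring

lemma hh_fourier (a : ℝ) (ha : 0 < a) (ha1 : a < 1) (X : ℂ) (hX : 0 < X.re) (hn : ‖X‖ = 1)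
    (τ : ℝ) : 𝓕 (hh a X) (τ / (4 * Real.pi)) =
      (Real.pi : ℂ) ^ (-(1 / 2 + I * τ) / 2) * Gamma ((1 / 2 + I * τ) / 2) *
        X ^ (-(1 / 2 + I * τ) / 2) * (2 * Qzeta (1 / 2 + I * τ) a) := by
  have hre : ((1 / 2 + I * τ) / 2 : ℂ).re = 1 / 4 := by simp; norm_num
  have him : ((1 / 2 + I * τ) / 2 : ℂ).im = τ / 2 := by simp
  have h := (HH_mellin a ha ha1 X hX hn ((1 / 2 + I * τ) / 2) (by rw [hre]; norm_num)
    (by rw [hre]; norm_num)).2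
  rw [mellin_eq_fourier, hre, him] at h
  rw [show -(1 / 2 + I * (τ : ℂ)) / 2 = -((1 / 2 + I * τ) / 2) by ring]
  rw [show 2 * ((1 / 2 + I * (τ : ℂ)) / 2) = 1 / 2 + I * τ by ring] at h
  rw [← h]
  unfold hh
  rw [show τ / (4 * Real.pi) = τ / 2 / (2 * Real.pi) by field_simp; norm_num]

noncomputable def mker (k y : ℝ) : ℂ := ∫ u in (-k)..k, cexp (-(I * y / 2) * u)

lemma mker_norm_sq (k : ℝ) (hk : 0 < k) (y : ℝ) : ‖mker k y‖ ^ 2 ≤ pk k y := by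
  have hu : ∀ u : ℝ, ‖cexp (-(I * y / 2) * u)‖ = 1 := by
    intro u
    rw [show -(I * (y : ℂ) / 2) * u = ((-(y * u / 2) : ℝ) : ℂ) * I by push_cast; ring,
      norm_exp_ofReal_mul_I]
  have h1 : ‖mker k y‖ ≤ 2 * k := by
    have := intervalIntegral.norm_integral_le_of_norm_le_const (a := -k) (b := k)
      (f := fun u : ℝ => cexp (-(I * y / 2) * u)) (C := 1) (fun u _ => (hu u).le)
    rw [show k - -k = 2 * k by ring, abs_of_pos (by positivity), one_mul] at this
    exact this
  have h2 : |y| * ‖mker k y‖ ≤ 4 := by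
    by_cases hy : y = 0
    · simp [hy]
    have hc : -(I * (y : ℂ) / 2) ≠ 0 := by simp [hy]
    unfold mker
    rw [integral_exp_mul_complex hc, norm_div]
    have : ‖-(I * (y : ℂ) / 2)‖ = |y| / 2 := by simp
    rw [this]
    have h3 := norm_sub_le (cexp (-(I * y / 2) * (k : ℝ))) (cexp (-(I * y / 2) * ((-k : ℝ) : ℂ)))
    rw [hu, hu] at h3
    have : 0 < |y| := abs_pos.2 hy
    calc _ = 2 * ‖cexp (-(I * y / 2) * (k : ℝ)) - cexp (-(I * y / 2) * ((-k : ℝ) : ℂ))‖ := by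
          field_simp
      _ ≤ 4 := by linarith
  unfold pk
  rw [le_div_iff₀ (by positivity)]
  have h4 : ‖mker k y‖ ^ 2 ≤ (2 * k) ^ 2 := by gcongr
  have h5 : (|y| * ‖mker k y‖) ^ 2 ≤ 4 ^ 2 := by gcongr
  rw [mul_pow, sq_abs] at h5
  have h6 := mul_le_mul_of_nonneg_left h5 (sq_nonneg k)
  nlinarith

lemma mker_continuous (k : ℝ) : Continuous (mker k) := by
  unfold mker
  exact intervalIntegral.continuous_parametric_intervalIntegral_of_continuous' (by fun_prop) _ _

lemma fourier_avg (g : ℝ → ℂ) (hg : Integrable g) (k : ℝ) (hk : 0 < k) (t : ℝ) :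
    ∫ u in (-k)..k, 𝓕 g ((t + u) / (4 * Real.pi)) =
      𝓕 (fun y => g y * mker k y) (t / (4 * Real.pi)) := by
  simp only [Real.fourier_real_eq_integral_exp_smul]
  rw [intervalIntegral.integral_of_le (by linarith), integral_integral_swap]
  · refine integral_congr_ae (Filter.Eventually.of_forall fun y => ?_)
    simp only [smul_eq_mul, mker]
    rw [intervalIntegral.integral_of_le (by linarith), ← integral_const_mul, ← integral_const_mul]
    refine integral_congr_ae (Filter.Eventually.of_forall fun u => ?_)
    simp only
    have hpi : (Real.pi : ℂ) ≠ 0 := ofReal_ne_zero.2 Real.pi_ne_zero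
    rw [mul_left_comm, mul_comm (g y), ← Complex.exp_add]
    congr 2
    push_cast
    field_simp
    ring
  · have hI : Integrable (fun p : ℝ × ℝ => g p.2)
        ((volume.restrict (Set.Ioc (-k) k)).prod volume) := hg.comp_snd _
    refine hI.bdd_mul (c := 1) ?_ ?_
    · exact Continuous.aestronglyMeasurable (by fun_prop)
    · refine Filter.Eventually.of_forall fun p => ?_
      rw [norm_exp_ofReal_mul_I]

end

section
open Complex MeasureTheory
open FourierTransform

lemma HH_symm (a : ℝ) (X : ℂ) (hX : 0 < X.re) (hn : ‖X‖ = 1) (t : ℝ) (ht : 0 < t) :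
    ‖HH a X (1 / t)‖ = Real.sqrt t * ‖HH a X t‖ := by
  have hX0 : X ≠ 0 := by rintro rfl; simp at hX
  have hXc : (starRingEnd ℂ) X ≠ 0 := by simpa using hX0
  have hcX := conj_re_pos X hX
  have hc : (starRingEnd ℂ) X * X = 1 := by
    rw [mul_comm, Complex.mul_conj']
    simp [hn]
  have ht0 : (t : ℂ) ≠ 0 := ofReal_ne_zero.2 ht.ne'
  set E : ℂ := ((starRingEnd ℂ) X) ^ (1 / 2 : ℂ) with hE
  have hE0 : E ≠ 0 := by simp [hE, cpow_eq_zero_iff, hX0]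
  have hinv : ((starRingEnd ℂ) X)⁻¹ = X := inv_eq_of_mul_eq_one_right hc
  have hEc : (starRingEnd ℂ) E = E⁻¹ := by
    rw [hE, ← inv_cpow _ _ (arg_ne_pi _ hcX), hinv]
    have h := cpow_conj ((starRingEnd ℂ) X) (1 / 2 : ℂ) (arg_ne_pi _ hcX)
    rw [conj_conj] at h
    have h2 : (starRingEnd ℂ) (1 / 2 : ℂ) = 1 / 2 := by
      rw [map_div₀, map_one, map_ofNat]
    rw [h2] at h
    rw [h, conj_conj]
  have hEn : ‖E‖ = 1 := by
    have : (starRingEnd ℂ) E * E = 1 := by rw [hEc, inv_mul_cancel₀ hE0]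
    have h2 := congrArg norm this
    rw [norm_mul, RCLike.norm_conj, norm_one] at h2
    nlinarith [norm_nonneg E]
  have hs : (t : ℂ) ^ (1 / 2 : ℂ) = (Real.sqrt t : ℝ) := by
    rw [Real.sqrt_eq_rpow, ofReal_cpow ht.le]
    push_cast
    rfl
  have hs0 : ((Real.sqrt t : ℝ) : ℂ) ≠ 0 := ofReal_ne_zero.2 (Real.sqrt_pos.2 ht).ne'
  have hs' : (t : ℂ) ^ (-(1 / 2) : ℂ) = ((Real.sqrt t : ℝ) : ℂ)⁻¹ := by
    rw [cpow_neg, hs]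
  have hs'' : ((1 / t : ℝ) : ℂ) ^ (-(1 / 2) : ℂ) = ((Real.sqrt t : ℝ) : ℂ) := by
    rw [one_div, ofReal_inv, inv_cpow _ _ (by rw [arg_ofReal_of_nonneg ht.le]; exact Real.pi_pos.ne), hs', inv_inv]
  have e : X * ((1 / t : ℝ) : ℂ) = 1 / (t * (starRingEnd ℂ) X) := by
    rw [one_div (_ * _), mul_inv, hinv]
    push_cast
    ring
  have hth : Th a (X * ((1 / t : ℝ) : ℂ)) = (Real.sqrt t : ℝ) * E * (starRingEnd ℂ) (Th a (X * t)) := by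
    rw [e, Th_feq a _ (by rw [re_ofReal_mul]; positivity), cpow_real_mul t ht _ hXc, hs, Th_conj,
      map_mul, conj_ofReal, mul_comm (t : ℂ)]
  have key : HH a X (1 / t) = (Real.sqrt t : ℝ) * E * (starRingEnd ℂ) (HH a X t) := by
    unfold HH
    rw [hth, hs'', hs', ← hE]
    simp only [map_sub, map_mul, map_one, hEc, map_inv₀, conj_ofReal]
    field_simp
    ring
  rw [key, norm_mul, norm_mul, RCLike.norm_conj, hEn, norm_real, Real.norm_of_nonneg (Real.sqrt_nonneg t), mul_one]

lemma hh_symm (a : ℝ) (X : ℂ) (hX : 0 < X.re) (hn : ‖X‖ = 1) (u : ℝ) :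
    ‖hh a X (-u)‖ = ‖hh a X u‖ := by
  unfold hh
  rw [norm_smul, norm_smul]
  have h := HH_symm a X hX hn (Real.exp (-u)) (Real.exp_pos _)
  rw [one_div, ← Real.exp_neg] at h
  rw [h, ← mul_assoc]
  congr 1
  rw [Real.norm_of_nonneg (Real.exp_pos _).le, Real.norm_of_nonneg (Real.exp_pos _).le,
    ← Real.exp_half, ← Real.exp_add]
  congr 1
  ring

lemma hh_neg_bound (a : ℝ) (ha : 0 < a) (ha1 : a < 1) (X : ℂ) (hX : 0 < X.re) (hn : ‖X‖ = 1) (y : ℝ)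
    (hy : 0 < y) :
    ‖hh a X y‖ ^ 2 ≤ 5 * (Real.exp (y / 2) * ‖gs c1 a (X * Real.exp y)‖ ^ 2
      + Real.exp (y / 2) * ‖gs c1 (1 - a) (X * Real.exp y)‖ ^ 2
      + Real.exp (y / 2) * ‖gs (c3 a) 1 (X * Real.exp y)‖ ^ 2
      + Real.exp (y / 2) * ‖gs (c3 (1 - a)) 1 (X * Real.exp y)‖ ^ 2 + 1) := by
  rw [← hh_symm a X hX hn]
  unfold hh
  have hw : 0 < (X * ((Real.exp y : ℝ) : ℂ)).re := by
    rw [re_mul_ofReal]; exact mul_pos hX (Real.exp_pos _)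
  have hX0 : X ≠ 0 := by rintro rfl; simp at hX
  have hXc : (starRingEnd ℂ) X ≠ 0 := by simpa using hX0
  have hEn : ‖((starRingEnd ℂ) X) ^ (1 / 2 : ℂ)‖ = 1 := by
    have h1 : (((starRingEnd ℂ) X) ^ (1 / 2 : ℂ)) ^ 2 = (starRingEnd ℂ) X := by
      rw [← cpow_nat_mul]; norm_num
    have h2 := congrArg norm h1
    rw [norm_pow, RCLike.norm_conj, hn] at h2
    exact (pow_eq_one_iff_of_nonneg (norm_nonneg _) two_ne_zero).1 h2
  have hp : ‖((Real.exp y : ℝ) : ℂ) ^ (-(1 / 2) : ℂ)‖ = Real.exp (-(y / 2)) := by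
    rw [norm_cpow_eq_rpow_re_of_pos (Real.exp_pos y), ← Real.exp_mul]
    congr 1
    simp
    ring
  rw [norm_smul, Real.norm_of_nonneg (Real.exp_pos _).le, mul_pow, neg_neg]
  unfold HH
  rw [Th_eq a ha ha1 _ hw]
  set f1 := gs c1 a (X * Real.exp y)
  set f2 := gs c1 (1 - a) (X * Real.exp y)
  set f3 := gs (c3 a) 1 (X * Real.exp y)
  set f4 := gs (c3 (1 - a)) 1 (X * Real.exp y)
  set f5 := ((starRingEnd ℂ) X) ^ (1 / 2 : ℂ) * ((Real.exp y : ℝ) : ℂ) ^ (-(1 / 2) : ℂ) with hf5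
  have h5 : ‖f5‖ = Real.exp (-(y / 2)) := by rw [hf5, norm_mul, hEn, hp, one_mul]
  have htri : ‖1 + (f1 + f2 + f3 + f4) - 1 - f5‖ ≤ ‖f1‖ + ‖f2‖ + ‖f3‖ + ‖f4‖ + ‖f5‖ := by
    rw [add_sub_cancel_left]
    refine (norm_sub_le _ _).trans ?_
    gcongr
    exact norm_add₄_le
  have hsq : ‖1 + (f1 + f2 + f3 + f4) - 1 - f5‖ ^ 2 ≤
      5 * (‖f1‖ ^ 2 + ‖f2‖ ^ 2 + ‖f3‖ ^ 2 + ‖f4‖ ^ 2 + ‖f5‖ ^ 2) := by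
    refine (pow_le_pow_left₀ (norm_nonneg _) htri 2).trans ?_
    nlinarith [sq_nonneg (‖f1‖ - ‖f2‖), sq_nonneg (‖f1‖ - ‖f3‖), sq_nonneg (‖f1‖ - ‖f4‖),
      sq_nonneg (‖f1‖ - ‖f5‖), sq_nonneg (‖f2‖ - ‖f3‖), sq_nonneg (‖f2‖ - ‖f4‖),
      sq_nonneg (‖f2‖ - ‖f5‖), sq_nonneg (‖f3‖ - ‖f4‖), sq_nonneg (‖f3‖ - ‖f5‖),
      sq_nonneg (‖f4‖ - ‖f5‖)]
  have he : Real.exp (-(1 / 4) * -y) ^ 2 = Real.exp (y / 2) := by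
    rw [← Real.exp_nat_mul]; congr 1; push_cast; ring
  rw [he]
  have h6 : Real.exp (y / 2) * ‖f5‖ ^ 2 ≤ 1 := by
    rw [h5, ← Real.exp_nat_mul, ← Real.exp_add, Real.exp_le_one_iff]
    push_cast
    linarith
  have := mul_le_mul_of_nonneg_left hsq (Real.exp_pos (y / 2)).le
  linarith

lemma gs_meas (c : ℕ → ℂ) (hc : ∀ n, ‖c n‖ ≤ 2) (b : ℝ) (hb : 0 < b) (X : ℂ) (hX : 0 < X.re) :
    Measurable (fun y : ℝ => gs c b (X * Real.exp y)) := by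
  refine measurable_of_tendsto_metrizable
    (f := fun N (y : ℝ) => ∑ n ∈ Finset.range N, gt c b (X * Real.exp y) n) (fun N => ?_) ?_
  · unfold gt
    exact Continuous.measurable (by fun_prop)
  · rw [tendsto_pi_nhds]
    intro y
    exact (gs_hasSum c hc b hb _ (by
      rw [re_mul_ofReal]; exact mul_pos hX (Real.exp_pos _))).tendsto_sum_nat

lemma gs_family (c : ℕ → ℂ) (hc : ∀ n, ‖c n‖ ≤ 2) (b : ℝ) (hb : 0 < b) (X : ℂ) (hX : 0 < X.re)
    (hX2 : 1 / 2 ≤ X.im) (k : ℝ) (hk : 0 < k) :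
    ∫⁻ y in Set.Ioi 0, ENNReal.ofReal (pk k y * Real.exp (y / 2) * ‖gs c b (X * Real.exp y)‖ ^ 2) ≤
      ENNReal.ofReal (bnd b X.re k) := by
  refine family_bound c hc b hb X.re hX X.im hX2 k hk (fun y => gs c b (X * Real.exp y)) fun y => ?_
  have := gs_hasSum c hc b hb (X * Real.exp y) (by
      rw [re_mul_ofReal]; exact mul_pos hX (Real.exp_pos _))
  convert this using 1
  funext n
  unfold tm gt
  rw [re_add_im, mul_assoc _ X]

lemma bnd_nonneg (b s k : ℝ) (hb : 0 < b) (hs : 0 < s) (hk : 0 < k) : 0 ≤ bnd b s k := by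
  unfold bnd
  have := Real.pi_pos
  positivity

lemma half_bound (a : ℝ) (ha : 0 < a) (ha1 : a < 1) (X : ℂ) (hX : 0 < X.re) (hn : ‖X‖ = 1)
    (hX2 : 1 / 2 ≤ X.im) (k : ℝ) (hk : 0 < k) :
    ∫⁻ y in Set.Ioi 0, ENNReal.ofReal (pk k y * ‖hh a X y‖ ^ 2) ≤
      ENNReal.ofReal (5 * (bnd a X.re k + bnd (1 - a) X.re k + bnd 1 X.re k + bnd 1 X.re k
        + 16 * Real.pi * k)) := by
  have hpm := (pk_continuous k).measurable
  have hm : ∀ (c : ℕ → ℂ) (_ : ∀ n, ‖c n‖ ≤ 2) (b : ℝ) (_ : 0 < b), Measurable (fun y : ℝ =>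
      ENNReal.ofReal (pk k y * Real.exp (y / 2) * ‖gs c b (X * Real.exp y)‖ ^ 2)) := by
    intro c hc b hb
    have := gs_meas c hc b hb X hX
    fun_prop
  have ha2 : 0 < 1 - a := by linarith
  have n1 := bnd_nonneg a X.re k ha hX hk
  have n2 := bnd_nonneg (1 - a) X.re k ha2 hX hk
  have n3 := bnd_nonneg 1 X.re k one_pos hX hk
  have n5 : 0 ≤ 16 * Real.pi * k := by have := Real.pi_pos; positivity
  have b5 : ∫⁻ y in Set.Ioi (0 : ℝ), ENNReal.ofReal (pk k y) ≤ ENNReal.ofReal (16 * Real.pi * k) := by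
    rw [← ofReal_integral_eq_lintegral_ofReal (pk_integrable k hk).integrableOn
      (Filter.Eventually.of_forall fun y => pk_nonneg k y)]
    exact ENNReal.ofReal_le_ofReal (pk_integral_Ioi k hk)
  calc ∫⁻ y in Set.Ioi 0, ENNReal.ofReal (pk k y * ‖hh a X y‖ ^ 2)
      ≤ ∫⁻ y in Set.Ioi 0, ENNReal.ofReal 5 *
        (ENNReal.ofReal (pk k y * Real.exp (y / 2) * ‖gs c1 a (X * Real.exp y)‖ ^ 2)
        + ENNReal.ofReal (pk k y * Real.exp (y / 2) * ‖gs c1 (1 - a) (X * Real.exp y)‖ ^ 2)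
        + ENNReal.ofReal (pk k y * Real.exp (y / 2) * ‖gs (c3 a) 1 (X * Real.exp y)‖ ^ 2)
        + ENNReal.ofReal (pk k y * Real.exp (y / 2) * ‖gs (c3 (1 - a)) 1 (X * Real.exp y)‖ ^ 2)
        + ENNReal.ofReal (pk k y)) := by
        refine setLIntegral_mono' measurableSet_Ioi fun y hy => ?_
        have hp := pk_nonneg k y
        rw [← ENNReal.ofReal_add (by positivity) (by positivity),
          ← ENNReal.ofReal_add (by positivity) (by positivity),
          ← ENNReal.ofReal_add (by positivity) (by positivity),
          ← ENNReal.ofReal_add (by positivity) (by positivity),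
          ← ENNReal.ofReal_mul (by norm_num)]
        refine ENNReal.ofReal_le_ofReal ?_
        have := mul_le_mul_of_nonneg_left (hh_neg_bound a ha ha1 X hX hn y hy) hp
        linarith
    _ ≤ _ := by
        rw [lintegral_const_mul' _ _ ENNReal.ofReal_ne_top, lintegral_add_right _ (by fun_prop),
          lintegral_add_right _ (hm _ (c3_le (1 - a)) 1 one_pos),
          lintegral_add_right _ (hm _ (c3_le a) 1 one_pos),
          lintegral_add_right _ (hm _ c1_le (1 - a) ha2),
          ENNReal.ofReal_mul (by norm_num), ENNReal.ofReal_add (by positivity) n5,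
          ENNReal.ofReal_add (by positivity) n3,
          ENNReal.ofReal_add (by positivity) n3,
          ENNReal.ofReal_add n1 n2]
        gcongr
        · exact gs_family _ c1_le a ha X hX hX2 k hk
        · exact gs_family _ c1_le (1 - a) ha2 X hX hX2 k hk
        · exact gs_family _ (c3_le a) 1 one_pos X hX hX2 k hk
        · exact gs_family _ (c3_le (1 - a)) 1 one_pos X hX hX2 k hk

lemma full_bound (a : ℝ) (ha : 0 < a) (ha1 : a < 1) (X : ℂ) (hX : 0 < X.re) (hn : ‖X‖ = 1)
    (hX2 : 1 / 2 ≤ X.im) (k : ℝ) (hk : 0 < k) :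
    ∫⁻ y, ENNReal.ofReal (pk k y * ‖hh a X y‖ ^ 2) ≤
      ENNReal.ofReal (10 * (bnd a X.re k + bnd (1 - a) X.re k + bnd 1 X.re k + bnd 1 X.re k
        + 16 * Real.pi * k)) := by
  have hb := half_bound a ha ha1 X hX hn hX2 k hk
  have hneg : ∫⁻ y in Set.Iio 0, ENNReal.ofReal (pk k y * ‖hh a X y‖ ^ 2) =
      ∫⁻ y in Set.Ioi 0, ENNReal.ofReal (pk k y * ‖hh a X y‖ ^ 2) := by
    have h := (Measure.measurePreserving_neg (volume : Measure ℝ)).setLIntegral_comp_preimage_emb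
      (MeasurableEquiv.neg ℝ).measurableEmbedding
      (fun y => ENNReal.ofReal (pk k y * ‖hh a X y‖ ^ 2)) (Set.Ioi 0)
    rw [← h]
    have : (Neg.neg ⁻¹' Set.Ioi (0 : ℝ)) = Set.Iio 0 := by ext y; simp
    rw [this]
    refine lintegral_congr fun y => ?_
    rw [hh_symm a X hX hn]
    simp [pk]
  have hall : ∫⁻ y, ENNReal.ofReal (pk k y * ‖hh a X y‖ ^ 2) =
      (∫⁻ y in Set.Ioi 0, ENNReal.ofReal (pk k y * ‖hh a X y‖ ^ 2)) +
      ∫⁻ y in Set.Iio 0, ENNReal.ofReal (pk k y * ‖hh a X y‖ ^ 2) := by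
    rw [← lintegral_add_compl _ (measurableSet_Ioi (a := (0 : ℝ))), Set.compl_Ioi,
      setLIntegral_congr Iio_ae_eq_Iic]
  rw [hall, hneg]
  refine (add_le_add hb hb).trans ?_
  have n1 := bnd_nonneg a X.re k ha hX hk
  have n2 := bnd_nonneg (1 - a) X.re k (by linarith) hX hk
  have n3 := bnd_nonneg 1 X.re k one_pos hX hk
  have n5 : 0 ≤ 16 * Real.pi * k := by have := Real.pi_pos; positivity
  rw [← ENNReal.ofReal_add (by positivity) (by positivity)]
  refine ENNReal.ofReal_le_ofReal (le_of_eq (by ring))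

end

section
open Complex MeasureTheory
open FourierTransform

noncomputable def xx (δ : ℝ) : ℂ := Complex.exp (-Complex.I * Real.pi / 4 + Complex.I * δ / 2)
noncomputable def XX (δ : ℝ) : ℂ := cexp (((Real.pi / 2 - δ : ℝ) : ℂ) * I)

lemma XX_re (δ : ℝ) : (XX δ).re = Real.sin δ := by
  unfold XX
  rw [exp_ofReal_mul_I_re, Real.cos_pi_div_two_sub]

lemma XX_im (δ : ℝ) : (XX δ).im = Real.cos δ := by
  unfold XX
  rw [exp_ofReal_mul_I_im, Real.sin_pi_div_two_sub]

lemma XX_norm (δ : ℝ) : ‖XX δ‖ = 1 := norm_exp_ofReal_mul_I _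

lemma xx_form (δ : ℝ) : xx δ = cexp (((-(Real.pi / 2 - δ) / 2 : ℝ) : ℂ) * I) := by
  unfold xx
  congr 1
  push_cast
  ring

lemma xx_cpow (δ : ℝ) (h0 : 0 < δ) (h1 : δ < 1) (v : ℂ) :
    xx δ ^ (v - 1) = XX δ ^ (-v / 2) * cexp ((((Real.pi / 2 - δ) / 2 : ℝ) : ℂ) * I) := by
  have hpi := Real.pi_gt_three
  rw [xx_form]
  unfold XX
  rw [cpow_def_of_ne_zero (Complex.exp_ne_zero _), cpow_def_of_ne_zero (Complex.exp_ne_zero _),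
    log_exp (by rw [im_ofReal_mul, I_im]; linarith) (by rw [im_ofReal_mul, I_im]; linarith),
    log_exp (by rw [im_ofReal_mul, I_im]; linarith) (by rw [im_ofReal_mul, I_im]; linarith),
    ← Complex.exp_add]
  congr 1
  push_cast
  ring

lemma Ixk_norm (a : ℝ) (ha : 0 < a) (ha1 : a < 1) (δ : ℝ) (h0 : 0 < δ) (h1 : δ < 1) (k : ℝ)
    (hk : 0 < k) (t : ℝ) (hX : 0 < (XX δ).re) :
    ‖Ixk (xx δ) k (1 / 2 + Complex.I * t) a‖ =
      1 / (4 * Real.pi) * ‖𝓕 (fun y => hh a (XX δ) y * mker k y) (t / (4 * Real.pi))‖ := by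
  have hI := hh_integrable a ha ha1 (XX δ) hX (XX_norm δ)
  set e : ℂ := cexp ((((Real.pi / 2 - δ) / 2 : ℝ) : ℂ) * I) with he
  have hen : ‖e‖ = 1 := norm_exp_ofReal_mul_I _
  unfold Ixk
  have hfun : ∀ u : ℝ, (Real.pi : ℂ) ^ (-(1 / 2 + I * t + I * u) / 2) *
      Gamma ((1 / 2 + I * t + I * u) / 2) * Qzeta (1 / 2 + I * t + I * u) a *
      xx δ ^ (1 / 2 + I * t + I * u - 1) =
      (e / 2) * 𝓕 (hh a (XX δ)) ((t + u) / (4 * Real.pi)) := by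
    intro u
    rw [hh_fourier a ha ha1 (XX δ) hX (XX_norm δ), xx_cpow δ h0 h1, ← he]
    push_cast
    rw [show (1 / 2 + I * (t + u) : ℂ) = 1 / 2 + I * t + I * u by ring]
    ring
  simp only [hfun]
  rw [intervalIntegral.integral_const_mul, fourier_avg _ hI k hk t]
  simp only [norm_mul, norm_div, hen, norm_I, norm_one, norm_real, Real.norm_of_nonneg Real.pi_pos.le]
  norm_num
  ring

lemma second_moment_bound (a : ℝ) (ha : 0 < a) (ha1 : a < 1) (δ : ℝ) (h0 : 0 < δ) (h1 : δ < 1) (k : ℝ)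
    (hk : 0 < k) (hX : 0 < (XX δ).re) (hX2 : 1 / 2 ≤ (XX δ).im) :
    ∫ t : ℝ, (‖Ixk (xx δ) k (1 / 2 + Complex.I * t) a‖) ^ 2 ≤
      1 / (4 * Real.pi) * (10 * (bnd a (XX δ).re k + bnd (1 - a) (XX δ).re k + bnd 1 (XX δ).re k
        + bnd 1 (XX δ).re k + 16 * Real.pi * k)) := by
  have hI := hh_integrable a ha ha1 (XX δ) hX (XX_norm δ)
  have hpi := Real.pi_pos
  set g : ℝ → ℂ := fun y => hh a (XX δ) y * mker k y with hg
  have hmm : AEStronglyMeasurable (mker k) := (mker_continuous k).aestronglyMeasurable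
  have hgm : AEStronglyMeasurable g := hI.1.mul hmm
  have hgI : Integrable g := by
    refine hI.mul_bdd (c := Real.sqrt (8 * k ^ 2)) hmm (Filter.Eventually.of_forall fun y => ?_)
    exact Real.le_sqrt_of_sq_le ((mker_norm_sq k hk y).trans (pk_le k y))
  set B := 10 * (bnd a (XX δ).re k + bnd (1 - a) (XX δ).re k + bnd 1 (XX δ).re k
        + bnd 1 (XX δ).re k + 16 * Real.pi * k) with hB
  have n1 := bnd_nonneg a (XX δ).re k ha hX hk
  have n2 := bnd_nonneg (1 - a) (XX δ).re k (by linarith) hX hk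
  have n3 := bnd_nonneg 1 (XX δ).re k one_pos hX hk
  have hB0 : 0 ≤ B := by positivity
  have hle : ∫⁻ y, ENNReal.ofReal (‖g y‖ ^ 2) ≤ ENNReal.ofReal B := by
    refine (lintegral_mono fun y => ENNReal.ofReal_le_ofReal ?_).trans
      (full_bound a ha ha1 (XX δ) hX (XX_norm δ) hX2 k hk)
    simp only [hg]
    rw [norm_mul, mul_pow, mul_comm]
    exact mul_le_mul_of_nonneg_right (mker_norm_sq k hk y) (by positivity)
  have hsq : Integrable (fun y => ‖g y‖ ^ 2) := by
    refine ⟨hgm.norm.pow 2, ?_⟩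
    rw [hasFiniteIntegral_iff_ofReal (Filter.Eventually.of_forall fun y => by positivity)]
    exact hle.trans_lt ENNReal.ofReal_lt_top
  have hL2 : MemLp g 2 := (memLp_two_iff_integrable_sq_norm hgm).2 hsq
  have hInt : ∫ y, ‖g y‖ ^ 2 ≤ B := by
    rw [integral_eq_lintegral_of_nonneg_ae (Filter.Eventually.of_forall fun y => by positivity) hsq.1]
    exact ENNReal.toReal_le_of_le_ofReal hB0 hle
  have hP := plancherel_aux g hgI hL2
  simp only [Ixk_norm a ha ha1 δ h0 h1 k hk _ hX, mul_pow]
  rw [integral_const_mul, Measure.integral_comp_div (fun t => ‖𝓕 g t‖ ^ 2) (4 * Real.pi), hP,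
    abs_of_pos (by positivity), smul_eq_mul]
  calc _ = 1 / (4 * Real.pi) * ∫ y, ‖g y‖ ^ 2 := by field_simp
    _ ≤ _ := by gcongr

lemma bnd_delta (b s δ k : ℝ) (hb : 0 < b) (hδ : 0 < δ) (hδ1 : δ < 1) (hs : δ / 2 ≤ s) (hk : 0 < k) :
    bnd b s k ≤ 128 * Real.pi * (1 / b + 1) * k / Real.sqrt δ +
      256 * Zc ^ 2 * k ^ 2 * δ ^ (-(1 / 4) : ℝ) := by
  have hs0 : 0 < s := by linarith
  have hpi := Real.pi_pos
  unfold bnd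
  have e1 : (Real.sqrt s)⁻¹ ≤ 2 * (Real.sqrt δ)⁻¹ := by
    rw [← div_eq_mul_inv, inv_le_comm₀ (Real.sqrt_pos.2 hs0) (by positivity), inv_div]
    refine Real.le_sqrt_of_sq_le ?_
    rw [div_pow, Real.sq_sqrt hδ.le]
    linarith
  have e2 : s ^ (-(1 / 4) : ℝ) ≤ 2 * δ ^ (-(1 / 4) : ℝ) := by
    calc s ^ (-(1 / 4) : ℝ) ≤ (δ / 2) ^ (-(1 / 4) : ℝ) :=
          Real.rpow_le_rpow_of_nonpos (by positivity) hs (by norm_num)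
      _ = δ ^ (-(1 / 4) : ℝ) * 2 ^ (1 / 4 : ℝ) := by
          rw [Real.div_rpow hδ.le (by norm_num), Real.rpow_neg (by norm_num : (0:ℝ) ≤ 2), div_inv_eq_mul]
      _ ≤ δ ^ (-(1 / 4) : ℝ) * 2 := by
          gcongr
          calc (2 : ℝ) ^ (1 / 4 : ℝ) ≤ 2 ^ (1 : ℝ) :=
                Real.rpow_le_rpow_of_exponent_le (by norm_num) (by norm_num)
            _ = 2 := Real.rpow_one 2
      _ = _ := mul_comm _ _
  calc _ = 64 * Real.pi * (1 / b + 1) * k * (Real.sqrt s)⁻¹ + 128 * Zc ^ 2 * k ^ 2 * s ^ (-(1 / 4) : ℝ) := by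
        rw [div_eq_mul_inv]
    _ ≤ 64 * Real.pi * (1 / b + 1) * k * (2 * (Real.sqrt δ)⁻¹) +
        128 * Zc ^ 2 * k ^ 2 * (2 * δ ^ (-(1 / 4) : ℝ)) := by gcongr
    _ = _ := by rw [div_eq_mul_inv]; ring

lemma main_aux (a : ℝ) (ha : 0 < a) (ha' : a ≤ 1 / 2) : ∃ K > (0:ℝ), ∀ ε > (0:ℝ), ∃ δ₀ > (0:ℝ),
    ∀ δ : ℝ, 0 < δ → δ < δ₀ → ∀ k : ℝ, 0 < k →
      (1 / (2 * Real.pi)) * ∫ t : ℝ, (‖Ixk (xx δ) k (1 / 2 + Complex.I * t) a‖) ^ 2 <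
        (K * k + ε * k ^ 2) / Real.sqrt δ := by
  have ha1 : a < 1 := by linarith
  have hpi := Real.pi_pos
  have ha2 : 0 < 1 - a := by linarith
  set P : ℝ := 1 / (2 * Real.pi) * (1 / (4 * Real.pi) * 10) with hP
  have hP0 : 0 < P := by positivity
  set K0 : ℝ := P * (128 * Real.pi * (1 / a + 1) + 128 * Real.pi * (1 / (1 - a) + 1) +
    128 * Real.pi * (1 / 1 + 1) + 128 * Real.pi * (1 / 1 + 1) + 16 * Real.pi) with hK0
  have hK0p : 0 < K0 := by positivity
  set C0 : ℝ := P * (4 * (256 * Zc ^ 2)) with hC0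
  have hC0n : 0 ≤ C0 := by positivity
  refine ⟨K0 + 1, by positivity, fun ε hε => ⟨min 1 ((ε / (C0 + 1)) ^ 4), by positivity, ?_⟩⟩
  intro δ h0 hlt k hk
  have h1 : δ < 1 := hlt.trans_le (min_le_left _ _)
  have h2 : δ < (ε / (C0 + 1)) ^ 4 := hlt.trans_le (min_le_right _ _)
  have hsin : δ / 2 ≤ (XX δ).re := by
    rw [XX_re]
    have := Real.sin_gt_sub_cube h0
    nlinarith [mul_pos h0 h0, mul_lt_one_of_nonneg_of_lt_one_left h0.le h1 h1.le]
  have hcos : 1 / 2 ≤ (XX δ).im := by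
    rw [XX_im]
    have := Real.one_sub_sq_div_two_le_cos (x := δ)
    nlinarith
  have hX : 0 < (XX δ).re := by linarith
  have hmom := second_moment_bound a ha ha1 δ h0 h1 k hk hX hcos
  have b1 := bnd_delta a _ δ k ha h0 h1 hsin hk
  have b2 := bnd_delta (1 - a) _ δ k ha2 h0 h1 hsin hk
  have b3 := bnd_delta 1 _ δ k one_pos h0 h1 hsin hk
  have hsq : 0 < Real.sqrt δ := Real.sqrt_pos.2 h0
  have hsq1 : Real.sqrt δ ≤ 1 := Real.sqrt_le_one.2 h1.le
  have b5 : 16 * Real.pi * k ≤ 16 * Real.pi * k / Real.sqrt δ := by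
    rw [le_div_iff₀ hsq]
    exact mul_le_of_le_one_right (by positivity) hsq1
  have hq : δ ^ (-(1 / 4) : ℝ) = δ ^ (1 / 4 : ℝ) / Real.sqrt δ := by
    rw [Real.sqrt_eq_rpow, ← Real.rpow_sub h0]
    norm_num
  have hroot : C0 * δ ^ (1 / 4 : ℝ) ≤ ε := by
    have : δ ^ (1 / 4 : ℝ) ≤ ε / (C0 + 1) := by
      calc δ ^ (1 / 4 : ℝ) ≤ ((ε / (C0 + 1)) ^ 4) ^ (1 / 4 : ℝ) :=
            Real.rpow_le_rpow h0.le h2.le (by norm_num)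
        _ = ε / (C0 + 1) := by
            rw [← Real.rpow_natCast, ← Real.rpow_mul (by positivity)]
            norm_num
    calc C0 * δ ^ (1 / 4 : ℝ) ≤ C0 * (ε / (C0 + 1)) := by gcongr
      _ ≤ (C0 + 1) * (ε / (C0 + 1)) := by gcongr; linarith
      _ = ε := by field_simp
  have step : (1 / (2 * Real.pi)) * ∫ t : ℝ, (‖Ixk (xx δ) k (1 / 2 + Complex.I * t) a‖) ^ 2 ≤
      K0 * k / Real.sqrt δ + C0 * k ^ 2 * δ ^ (-(1 / 4) : ℝ) := by
    calc _ ≤ (1 / (2 * Real.pi)) * (1 / (4 * Real.pi) * (10 * (bnd a (XX δ).re k +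
          bnd (1 - a) (XX δ).re k + bnd 1 (XX δ).re k + bnd 1 (XX δ).re k + 16 * Real.pi * k))) := by
          gcongr
      _ = P * (bnd a (XX δ).re k +
          bnd (1 - a) (XX δ).re k + bnd 1 (XX δ).re k + bnd 1 (XX δ).re k + 16 * Real.pi * k) := by
          rw [hP]; ring
      _ ≤ P * (_ + _ + _ + _ + _) := by
          refine mul_le_mul_of_nonneg_left ?_ hP0.le
          exact add_le_add (add_le_add (add_le_add (add_le_add b1 b2) b3) b3) b5
      _ = _ := by rw [hK0, hC0]; ring
  refine step.trans_lt ?_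
  rw [hq, mul_div_assoc', ← add_div]
  refine div_lt_div_of_pos_right ?_ hsq
  have := mul_le_mul_of_nonneg_right hroot (sq_nonneg k)
  nlinarith

end

/-- Upper bound for the second moment of `I_{x,k}` on the critical line, with
`x = e^{−iπ/4} e^{iδ/2}`. -/
theorem second_moment_Ixk_upper_bound (a : ℝ) (ha : 0 < a) (ha' : a ≤ 1 / 2) :
    ∃ K > (0 : ℝ), ∀ ε > (0 : ℝ), ∃ δ₀ > (0 : ℝ), ∀ δ : ℝ, 0 < δ → δ < δ₀ → ∀ k : ℝ, 0 < k →
      (1 / (2 * Real.pi)) *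
          ∫ t : ℝ, (‖Ixk (Complex.exp (-Complex.I * Real.pi / 4 +
            Complex.I * δ / 2)) k (1 / 2 + Complex.I * t) a‖) ^ 2 <
        (K * k + ε * k ^ 2) / Real.sqrt δ := by
  exact main_aux a ha ha'
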